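/- arXiv:2211.12658 — 9 statements merged into one kernel-verified Lean document; each statement's English description precedes it below -/
import Mathlib

section
/- For every z ∈ ℂ ∖ ({0} ∪ {q^k : k ∈ ℤ} ∪ {−q^k : k ∈ ℤ}), the doubly infinite series Σ_{k=−∞}^{∞} 2 z q^k / (z² − q^{2k}) converges absolutely, and the resulting function h_q satisfies the q-difference equation h_q(qz) = h_q(z) for all such z. -/
open Complex Topology

/-- The function `h_q(z) = ∑_{k=-∞}^{∞} 2 z q^k / (z² - q^{2k})`. -/
noncomputable def hqfun (q : ℝ) (z : ℂ) : ℂ :=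
  ∑' k : ℤ, 2 * z * (q : ℂ) ^ k / (z ^ 2 - (q : ℂ) ^ (2 * k))

open Asymptotics in
theorem summable_norm_hq_term_nat (q : ℝ) (hq0 : 0 < q) (hq1 : q < 1) (w : ℂ) (hw : w ≠ 0) :
    Summable (fun n : ℕ => ‖2 * w * (q : ℂ) ^ n / (w ^ 2 - (q : ℂ) ^ (2 * n))‖) := by
  have hqn : ‖(q : ℂ)‖ < 1 := by simpa [abs_of_pos hq0] using hq1
  have hlim : Filter.Tendsto (fun n : ℕ => 2 * w / (w ^ 2 - (q : ℂ) ^ (2 * n)))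
      Filter.atTop (𝓝 (2 * w / (w ^ 2 - 0))) := by
    refine tendsto_const_nhds.div (tendsto_const_nhds.sub ?_)
      (by rw [sub_zero]; exact pow_ne_zero 2 hw)
    simp_rw [pow_mul]
    refine tendsto_pow_atTop_nhds_zero_of_norm_lt_one ?_
    rw [norm_pow]
    exact pow_lt_one₀ (norm_nonneg _) hqn two_ne_zero
  have hgeom : (fun n : ℕ => (q : ℂ) ^ n) =O[Filter.atTop] fun n : ℕ => q ^ n :=
    Asymptotics.isBigO_of_le _ fun n => by simp
  refine summable_of_isBigO_nat (summable_geometric_of_lt_one hq0.le hq1)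
    (((hlim.isBigO_one ℝ).mul hgeom).norm_left.congr (fun n => ?_) fun n => one_mul _)
  rw [div_mul_eq_mul_div]

theorem hq_term_neg (q z : ℂ) (hq : q ≠ 0) (hz : z ≠ 0) (k : ℤ) :
    2 * z * q ^ (-k) / (z ^ 2 - q ^ (2 * -k)) =
      -(2 * z⁻¹ * q ^ k / (z⁻¹ ^ 2 - q ^ (2 * k))) := by
  have hk : q ^ k ≠ 0 := zpow_ne_zero k hq
  rw [mul_comm 2 (-k), mul_comm 2 k, zpow_mul, zpow_mul, zpow_neg]
  generalize q ^ k = a at *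
  simp only [zpow_ofNat]
  by_cases h : z ^ 2 * a ^ 2 - 1 = 0
  · have h1 : z ^ 2 - a⁻¹ ^ 2 = 0 := by field_simp; linear_combination h
    have h2 : z⁻¹ ^ 2 - a ^ 2 = 0 := by field_simp; linear_combination -h
    rw [h1, h2]; simp
  · have h1 : z ^ 2 - a⁻¹ ^ 2 = (z ^ 2 * a ^ 2 - 1) / a ^ 2 := by field_simp
    have h2 : z⁻¹ ^ 2 - a ^ 2 = -(z ^ 2 * a ^ 2 - 1) / z ^ 2 := by field_simp; ring
    rw [h1, h2]
    field_simp

theorem hq_term_mul (q z : ℂ) (hq : q ≠ 0) (k : ℤ) :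
    2 * (q * z) * q ^ k / ((q * z) ^ 2 - q ^ (2 * k)) =
      2 * z * q ^ (k - 1) / (z ^ 2 - q ^ (2 * (k - 1))) := by
  have h1 : q ^ k = q * q ^ (k - 1) := by rw [← zpow_one_add₀ hq]; congr 1; ring
  have h2 : q ^ (2 * k) = q ^ 2 * q ^ (2 * (k - 1)) := by
    rw [← zpow_natCast, ← zpow_add₀ hq]; congr 1; push_cast; ring
  rw [h1, h2, mul_pow, ← mul_sub, ← mul_div_mul_left (2 * z * q ^ (k - 1)) _ (pow_ne_zero 2 hq)]
  congr 1
  ring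

theorem statement0 (q : ℝ) (hq0 : 0 < q) (hq1 : q < 1) (z : ℂ) (hz0 : z ≠ 0)
    (hzq : ∀ k : ℤ, z ≠ (q : ℂ) ^ k ∧ z ≠ -((q : ℂ) ^ k)) :
    Summable (fun k : ℤ => ‖2 * z * (q : ℂ) ^ k / (z ^ 2 - (q : ℂ) ^ (2 * k))‖) ∧
      hqfun q ((q : ℂ) * z) = hqfun q z := by
  have hq : (q : ℂ) ≠ 0 := by exact_mod_cast hq0.ne'
  refine ⟨Summable.of_nat_of_neg ?_ ?_, ?_⟩
  · exact_mod_cast summable_norm_hq_term_nat q hq0 hq1 z hz0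
  · simp_rw [hq_term_neg _ z hq hz0, norm_neg]
    exact_mod_cast summable_norm_hq_term_nat q hq0 hq1 z⁻¹ (inv_ne_zero hz0)
  · unfold hqfun
    simp_rw [hq_term_mul _ z hq]
    exact (Equiv.subRight (1 : ℤ)).tsum_eq
      (fun k : ℤ => 2 * z * (q : ℂ) ^ k / (z ^ 2 - (q : ℂ) ^ (2 * k)))
end

section
/- There exist an even entire function a : ℂ → ℂ with a(0) = 1 and an odd entire function b : ℂ → ℂ whose Taylor coefficient of z equals 1, such that each y ∈ {a, b} satisfies the q-difference equation y(q^{−2} z) + (q^{−3} z² (1 + q^{−1}) − (1 + q^{−1})) y(q^{−1} z) + q^{−1} (1 + q^{−4} z⁴) y(z) = 0 for all z ∈ ℂ. -/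
open Complex Topology

/-- The q-difference equation
`y(q⁻²z) + (q⁻³ z² (1+q⁻¹) − (1+q⁻¹)) y(q⁻¹z) + q⁻¹ (1+q⁻⁴ z⁴) y(z) = 0`,
required at every `z ∈ ℂ`. -/
def NearEq (q : ℝ) (y : ℂ → ℂ) : Prop :=
  ∀ z : ℂ,
    y ((q : ℂ)⁻¹ ^ 2 * z)
      + ((q : ℂ)⁻¹ ^ 3 * z ^ 2 * (1 + (q : ℂ)⁻¹) - (1 + (q : ℂ)⁻¹)) * y ((q : ℂ)⁻¹ * z)
      + (q : ℂ)⁻¹ * (1 + (q : ℂ)⁻¹ ^ 4 * z ^ 4) * y z = 0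

open Filter in
/-- A solution of a three-term recurrence whose coefficients tend to zero decays faster than any
geometric sequence. -/
theorem exists_abs_le_mul_pow_of_recurrence {v α β : ℕ → ℝ}
    (hα : Tendsto α atTop (𝓝 0)) (hβ : Tendsto β atTop (𝓝 0))
    (hv : ∀ m, v (m + 2) = α m * v (m + 1) + β m * v m) {r : ℝ} (hr : 0 < r) :
    ∃ C : ℝ, ∀ m, |v m| ≤ C * r ^ m := by
  have h1 : ∀ᶠ m in atTop, |α m| < r / 2 := by
    simpa [Real.dist_eq] using (Metric.tendsto_nhds.1 hα) (r / 2) (by positivity)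
  have h2 : ∀ᶠ m in atTop, |β m| < r ^ 2 / 2 := by
    simpa [Real.dist_eq] using (Metric.tendsto_nhds.1 hβ) (r ^ 2 / 2) (by positivity)
  obtain ⟨N, hN⟩ := eventually_atTop.1 (h1.and h2)
  refine ⟨∑ i ∈ Finset.range (N + 2), |v i| / r ^ i, fun m => ?_⟩
  set C := ∑ i ∈ Finset.range (N + 2), |v i| / r ^ i with hC
  have hC0 : 0 ≤ C := Finset.sum_nonneg fun i _ => by positivity
  induction m using Nat.strong_induction_on with
  | _ m ih =>
    by_cases hm : m < N + 2
    · rw [← div_le_iff₀ (by positivity)]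
      exact Finset.single_le_sum (f := fun i => |v i| / r ^ i) (fun i _ => by positivity)
        (Finset.mem_range.2 hm)
    · obtain ⟨k, rfl⟩ : ∃ k, m = k + 2 := ⟨m - 2, by omega⟩
      obtain ⟨ha, hb⟩ := hN k (by omega)
      calc |v (k + 2)| ≤ |α k| * |v (k + 1)| + |β k| * |v k| := by
            rw [hv, ← abs_mul, ← abs_mul]; exact abs_add_le _ _
        _ ≤ r / 2 * (C * r ^ (k + 1)) + r ^ 2 / 2 * (C * r ^ k) := by
            gcongr
            · exact ih _ (by omega)
            · exact ih _ (by omega)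
        _ = C * r ^ (k + 2) := by ring

theorem summable_norm_mul_pow {v : ℕ → ℝ} (hv : ∀ r > 0, ∃ C : ℝ, ∀ m, |v m| ≤ C * r ^ m) {R : ℝ}
    (hR : 0 < R) : Summable fun m => |v m| * R ^ m := by
  obtain ⟨C, hC⟩ := hv (1 / (2 * R)) (by positivity)
  refine Summable.of_nonneg_of_le (fun m => by positivity) (fun m => ?_)
    ((summable_geometric_of_lt_one (r := 1 / 2) (by norm_num) (by norm_num)).mul_left C)
  calc |v m| * R ^ m ≤ C * (1 / (2 * R)) ^ m * R ^ m := by gcongr; exact hC m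
    _ = C * (1 / 2) ^ m := by
      rw [mul_assoc, ← mul_pow]; congr 2; field_simp

theorem differentiable_tsum_mul_pow {v : ℕ → ℝ}
    (hv : ∀ r > 0, ∃ C : ℝ, ∀ m, |v m| ≤ C * r ^ m) :
    Differentiable ℂ fun w : ℂ => ∑' m, (v m : ℂ) * w ^ m := by
  intro w
  have hR : 0 < ‖w‖ + 1 := by positivity
  have h : DifferentiableOn ℂ (fun w : ℂ => ∑' m, (v m : ℂ) * w ^ m)
      (Metric.ball 0 (‖w‖ + 1)) := by
    refine differentiableOn_tsum_of_summable_norm (summable_norm_mul_pow hv hR)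
      (fun m => by fun_prop) Metric.isOpen_ball fun m x hx => ?_
    rw [norm_mul, norm_pow, Complex.norm_real, Real.norm_eq_abs]
    gcongr
    simpa using (mem_ball_zero_iff.1 hx).le
  exact h.differentiableAt (Metric.isOpen_ball.mem_nhds (by simp))

theorem hasSum_tsum_mul_pow {v : ℕ → ℝ}
    (hv : ∀ r > 0, ∃ C : ℝ, ∀ m, |v m| ≤ C * r ^ m) (w : ℂ) :
    HasSum (fun m => (v m : ℂ) * w ^ m) (∑' m, (v m : ℂ) * w ^ m) := by
  refine Summable.hasSum (Summable.of_norm_bounded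
    (summable_norm_mul_pow hv (R := ‖w‖ + 1) (by positivity)) fun m => ?_)
  rw [norm_mul, norm_pow, Complex.norm_real, Real.norm_eq_abs]
  gcongr
  simp

/-- The factor `(pⁿ - 1)(pⁿ - p)` that multiplies the coefficient of `zⁿ` in the equation. -/
noncomputable def indicial (p : ℝ) (n : ℕ) : ℝ := (p ^ n - 1) * (p ^ n - p)

theorem indicial_ne_zero {p : ℝ} (hp : 1 < p) {n : ℕ} (hn : 2 ≤ n) : indicial p n ≠ 0 := by
  have h1 : 1 < p ^ n := one_lt_pow₀ hp (by omega)
  have h2 : p < p ^ n := lt_self_pow₀ hp (by omega)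
  exact mul_ne_zero (by linarith) (by linarith)

/-- The coefficient of `z ^ (2 * m + s)` in the solution that starts with `z ^ s`. -/
noncomputable def nearCoeff (p : ℝ) (s : ℕ) : ℕ → ℝ
  | 0 => 1
  | 1 => -(p ^ (s + 3) * (1 + p)) / indicial p (s + 2)
  | m + 2 => -(p ^ (2 * m + s + 5) * (1 + p)) / indicial p (2 * m + s + 4) * nearCoeff p s (m + 1)
      + -p ^ 5 / indicial p (2 * m + s + 4) * nearCoeff p s m

open Filter in
theorem nearCoeff_bound {p : ℝ} (hp : 1 < p) (s : ℕ) :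
    ∀ r > 0, ∃ C : ℝ, ∀ m, |nearCoeff p s m| ≤ C * r ^ m := by
  have hx : Tendsto (fun m : ℕ => p ^ (2 * m + s + 4)) atTop atTop :=
    (tendsto_pow_atTop_atTop_of_one_lt hp).comp
      (tendsto_atTop_mono (fun m => (by omega : m ≤ 2 * m + s + 4)) tendsto_id)
  have hinv (c : ℝ) : Tendsto (fun m : ℕ => (p ^ (2 * m + s + 4) - c)⁻¹) atTop (𝓝 0) :=
    tendsto_inv_atTop_zero.comp (tendsto_atTop_add_const_right _ (-c) hx)
  have h1 (m : ℕ) : p ^ (2 * m + s + 4) - 1 ≠ 0 :=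
    left_ne_zero_of_mul (indicial_ne_zero hp (by omega))
  have h2 (m : ℕ) : p ^ (2 * m + s + 4) - p ≠ 0 :=
    right_ne_zero_of_mul (indicial_ne_zero hp (by omega))
  refine fun r hr => exists_abs_le_mul_pow_of_recurrence ?_ ?_ (fun m => rfl) hr
  · have h := (((hinv 1).const_add 1).mul (hinv p)).const_mul (-(p * (1 + p)))
    simp only [mul_zero] at h
    refine h.congr fun m => ?_
    have := h1 m
    have := h2 m
    rw [indicial]
    field_simp
    ring
  · have h := ((hinv 1).mul (hinv p)).const_mul (-p ^ 5)
    simp only [mul_zero] at h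
    refine h.congr fun m => ?_
    rw [indicial, div_eq_mul_inv, mul_inv]

/-- The power series with coefficients `nearCoeff p s`; `z ^ s * nearSeries p s (z ^ 2)` solves the
equation. -/
noncomputable def nearSeries (p : ℝ) (s : ℕ) (w : ℂ) : ℂ := ∑' m, (nearCoeff p s m : ℂ) * w ^ m

theorem differentiable_nearSeries {p : ℝ} (hp : 1 < p) (s : ℕ) :
    Differentiable ℂ (nearSeries p s) :=
  differentiable_tsum_mul_pow (nearCoeff_bound hp s)

theorem nearSeries_zero (p : ℝ) (s : ℕ) : nearSeries p s 0 = 1 := by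
  rw [nearSeries, tsum_eq_single 0 fun m hm => by simp [hm]]
  simp [nearCoeff]

theorem nearSeries_equation {p : ℝ} (hp : 1 < p) {s : ℕ} (hs : s < 2) (w : ℂ) :
    (p : ℂ) ^ (2 * s) * nearSeries p s (p ^ 4 * w)
      + (p ^ 3 * w * (1 + p) - (1 + p)) * (p ^ s * nearSeries p s (p ^ 2 * w))
      + p * (1 + p ^ 4 * w ^ 2) * nearSeries p s w = 0 := by
  have hsum (x : ℂ) : HasSum (fun m => (nearCoeff p s m : ℂ) * x ^ m) (nearSeries p s x) :=
    hasSum_tsum_mul_pow (nearCoeff_bound hp s) x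
  have hA : HasSum (fun m => (indicial p (2 * m + s) : ℂ) * nearCoeff p s m * w ^ m)
      ((p : ℂ) ^ (2 * s) * nearSeries p s (p ^ 4 * w)
        - (1 + p) * (p ^ s * nearSeries p s (p ^ 2 * w)) + p * nearSeries p s w) := by
    convert! (((hsum (p ^ 4 * w)).mul_left ((p : ℂ) ^ (2 * s))).sub
      (((hsum (p ^ 2 * w)).mul_left ((p : ℂ) ^ s)).mul_left (1 + (p : ℂ)))).add
      ((hsum w).mul_left (p : ℂ)) using 2 with m
    rw [indicial]
    push_cast
    ring
  have hB : HasSum (fun m => (p : ℂ) ^ (2 * m + s + 3) * (1 + p) * nearCoeff p s m * w ^ (m + 1))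
      (p ^ 3 * w * (1 + p) * (p ^ s * nearSeries p s (p ^ 2 * w))) := by
    convert! ((hsum (p ^ 2 * w)).mul_left ((p : ℂ) ^ s)).mul_left (p ^ 3 * w * (1 + (p : ℂ)))
      using 2 with m
    ring
  have hD : HasSum (fun m => (p : ℂ) ^ 5 * nearCoeff p s m * w ^ (m + 2))
      (p ^ 5 * w ^ 2 * nearSeries p s w) := by
    convert! (hsum w).mul_left ((p : ℂ) ^ 5 * w ^ 2) using 2 with m
    ring
  have h0 : indicial p s = 0 := by
    interval_cases s <;> simp [indicial]
  have h1 : indicial p (s + 2) * nearCoeff p s 1 + p ^ (s + 3) * (1 + p) = 0 := by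
    have := indicial_ne_zero hp (show 2 ≤ s + 2 by omega)
    rw [nearCoeff]
    field_simp
    ring
  have h2 (m : ℕ) : indicial p (2 * m + s + 4) * nearCoeff p s (m + 2)
      + p ^ (2 * m + s + 5) * (1 + p) * nearCoeff p s (m + 1) + p ^ 5 * nearCoeff p s m = 0 := by
    have := indicial_ne_zero hp (show 2 ≤ 2 * m + s + 4 by omega)
    rw [nearCoeff]
    field_simp
    ring
  have hA' := (hasSum_nat_add_iff' 2).2 hA
  have hB' := (hasSum_nat_add_iff' 1).2 hB
  have hsumzero := ((hA'.add hB').add hD).unique (hasSum_zero.congr_fun fun m => by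
    have h := congrArg (fun x : ℝ => (x : ℂ)) (h2 m)
    push_cast at h
    rw [show 2 * (m + 2) + s = 2 * m + s + 4 by ring,
      show 2 * (m + 1) + s + 3 = 2 * m + s + 5 by ring]
    linear_combination w ^ (m + 2) * h)
  have h1' := congrArg (fun x : ℝ => (x : ℂ)) h1
  push_cast at h1'
  simp only [Finset.sum_range_succ, Finset.sum_range_zero, mul_zero, zero_add, h0, mul_one,
    pow_one, pow_zero, nearCoeff.eq_1, add_comm 2 s, Complex.ofReal_zero, Complex.ofReal_one] at hsumzero
  linear_combination hsumzero + w * h1'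

theorem nearEq_pow_mul_nearSeries {q : ℝ} (hq0 : 0 < q) (hq1 : q < 1) {s : ℕ} (hs : s < 2) :
    NearEq q fun z => z ^ s * nearSeries q⁻¹ s (z ^ 2) := by
  intro z
  have h := nearSeries_equation ((one_lt_inv₀ hq0).2 hq1) hs (z ^ 2)
  rw [Complex.ofReal_inv] at h
  beta_reduce
  rw [show ((q : ℂ)⁻¹ ^ 2 * z) ^ 2 = (q : ℂ)⁻¹ ^ 4 * z ^ 2 by ring, mul_pow (q : ℂ)⁻¹ z 2]
  linear_combination z ^ s * h

theorem statement4 (q : ℝ) (hq0 : 0 < q) (hq1 : q < 1) :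
    ∃ a b : ℂ → ℂ,
      Differentiable ℂ a ∧ Differentiable ℂ b ∧
      (∀ z : ℂ, a (-z) = a z) ∧ (∀ z : ℂ, b (-z) = -b z) ∧
      a 0 = 1 ∧ deriv b 0 = 1 ∧
      NearEq q a ∧ NearEq q b := by
  have hdiff (s : ℕ) : Differentiable ℂ fun z : ℂ => nearSeries q⁻¹ s (z ^ 2) :=
    (differentiable_nearSeries ((one_lt_inv₀ hq0).2 hq1) s).comp (differentiable_pow 2)
  refine ⟨fun z => z ^ 0 * nearSeries q⁻¹ 0 (z ^ 2), fun z => z ^ 1 * nearSeries q⁻¹ 1 (z ^ 2),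
    (differentiable_pow 0).mul (hdiff 0), (differentiable_pow 1).mul (hdiff 1),
    fun z => by simp, fun z => by simp, by simp [nearSeries_zero], ?_,
    nearEq_pow_mul_nearSeries hq0 hq1 (by norm_num),
    nearEq_pow_mul_nearSeries hq0 hq1 (by norm_num)⟩
  have h := (hasDerivAt_id (0 : ℂ)).mul (hdiff 1 0).hasDerivAt
  simpa [nearSeries_zero, Pi.mul_def] using h.deriv
end

section
/- (a) If y : ℂ → ℂ satisfies y(q^{−2}z) + (q^{−3} z² (1+q^{−1}) − (1+q^{−1})) y(q^{−1}z) + q^{−1}(1+q^{−4} z⁴) y(z) = 0 for all z, then v(z) := y(z) g(z) w(z) satisfies (q⁶ z^{−4} + q^{−2}) v(q^{−2}z) + (q z^{−2}(1+q) − q^{−1}(1+q^{−1})) v(q^{−1}z) + q^{−1} v(z) = 0 at every z ∈ ℂ ∖ {0} where all the quantities involved are defined. (b) There exist functions φ_even(z) = Σ_{j=0}^{∞} v_{2j} z^{−2j} with v_0 = 1 and φ_odd(z) = Σ_{j=0}^{∞} v_{2j+1} z^{−2j−1} with v_1 = 1, both series converging for all z ∈ ℂ ∖ {0}, each of which satisfies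 (q⁶ z^{−4} + q^{−2}) v(q^{−2}z) + (q z^{−2}(1+q) − q^{−1}(1+q^{−1})) v(q^{−1}z) + q^{−1} v(z) = 0 for all z ∈ ℂ ∖ {0}. -/
open Complex Topology

/-- The q-Pochhammer symbol `(a;qq)_∞ = ∏_{j=0}^∞ (1 - a qq^j)`. -/
noncomputable def qpoch (a qq : ℂ) : ℂ := ∏' j : ℕ, (1 - a * qq ^ j)

/-- `g(z) = (z²;q²)_∞ (q² z⁻²;q²)_∞`. -/
noncomputable def gfun (q : ℝ) (z : ℂ) : ℂ :=
  qpoch (z ^ 2) ((q : ℂ) ^ 2) * qpoch ((q : ℂ) ^ 2 * z⁻¹ ^ 2) ((q : ℂ) ^ 2)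

/-- The weight `w(z) = 1/(-z⁴;q⁴)_∞`. -/
noncomputable def wfun (q : ℝ) (z : ℂ) : ℂ := (qpoch (-z ^ 4) ((q : ℂ) ^ 4))⁻¹

/-- The q-difference equation
`(q⁶ z⁻⁴ + q⁻²) v(q⁻²z) + (q z⁻²(1+q) − q⁻¹(1+q⁻¹)) v(q⁻¹z) + q⁻¹ v(z) = 0` at the point `z`. -/
def VEqAt (q : ℝ) (v : ℂ → ℂ) (z : ℂ) : Prop :=
  ((q : ℂ) ^ 6 * z⁻¹ ^ 4 + (q : ℂ)⁻¹ ^ 2) * v ((q : ℂ)⁻¹ ^ 2 * z)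
    + ((q : ℂ) * z⁻¹ ^ 2 * (1 + (q : ℂ)) - (q : ℂ)⁻¹ * (1 + (q : ℂ)⁻¹)) * v ((q : ℂ)⁻¹ * z)
    + (q : ℂ)⁻¹ * v z = 0

lemma qpoch_eq_mul (a : ℂ) {Q : ℂ} (hQ : ‖Q‖ < 1) :
    qpoch a Q = (1 - a) * qpoch (a * Q) Q := by
  have hs : Summable fun j : ℕ => ‖-(a * Q * Q ^ j)‖ := by
    simp only [norm_neg, norm_mul, norm_pow]
    exact (summable_geometric_of_lt_one (norm_nonneg _) hQ).mul_left _
  have hm : Multipliable fun j : ℕ => 1 - a * Q ^ (j + 1) := by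
    refine (multipliable_one_add_of_summable hs).congr fun j => ?_
    ring
  unfold qpoch
  rw [tprod_eq_zero_mul' (f := fun j : ℕ => 1 - a * Q ^ j) hm]
  simp only [pow_zero, mul_one]
  congr 1
  refine tprod_congr fun j => ?_
  ring

lemma gfun_inv_mul {q : ℝ} (hq0 : 0 < q) (hq1 : q < 1) {z : ℂ} (hz : z ≠ 0) :
    gfun q ((q : ℂ)⁻¹ * z) = -(z ^ 2 * (q : ℂ)⁻¹ ^ 2) * gfun q z := by
  have hq : (q : ℂ) ≠ 0 := by exact_mod_cast hq0.ne'
  have hQ : ‖(q : ℂ) ^ 2‖ < 1 := by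
    rw [norm_pow, Complex.norm_of_nonneg hq0.le]
    exact pow_lt_one₀ hq0.le hq1 two_ne_zero
  unfold gfun
  rw [qpoch_eq_mul (((q : ℂ)⁻¹ * z) ^ 2) hQ, qpoch_eq_mul ((q : ℂ) ^ 2 * z⁻¹ ^ 2) hQ,
    show ((q : ℂ)⁻¹ * z) ^ 2 * (q : ℂ) ^ 2 = z ^ 2 by field_simp,
    show (q : ℂ) ^ 2 * ((q : ℂ)⁻¹ * z)⁻¹ ^ 2 = (q : ℂ) ^ 2 * z⁻¹ ^ 2 * (q : ℂ) ^ 2 by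
      field_simp]
  have h : 1 - ((q : ℂ)⁻¹ * z) ^ 2
      = -(z ^ 2 * (q : ℂ)⁻¹ ^ 2) * (1 - (q : ℂ) ^ 2 * z⁻¹ ^ 2) := by
    field_simp
    ring
  rw [h]
  ring

lemma qpoch_inv_mul {q : ℝ} (hq0 : 0 < q) (hq1 : q < 1) (z : ℂ) :
    qpoch (-((q : ℂ)⁻¹ * z) ^ 4) ((q : ℂ) ^ 4)
      = (1 + (q : ℂ)⁻¹ ^ 4 * z ^ 4) * qpoch (-z ^ 4) ((q : ℂ) ^ 4) := by
  have hq : (q : ℂ) ≠ 0 := by exact_mod_cast hq0.ne'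
  have hQ : ‖(q : ℂ) ^ 4‖ < 1 := by
    rw [norm_pow, Complex.norm_of_nonneg hq0.le]
    exact pow_lt_one₀ hq0.le hq1 four_ne_zero
  rw [qpoch_eq_mul _ hQ, show -((q : ℂ)⁻¹ * z) ^ 4 * (q : ℂ) ^ 4 = -z ^ 4 by field_simp]
  ring

lemma NearEq.vEqAt {q : ℝ} (hq0 : 0 < q) (hq1 : q < 1) {y : ℂ → ℂ} (hy : NearEq q y)
    {z : ℂ} (hz : z ≠ 0)
    (h₁ : qpoch (-((q : ℂ)⁻¹ * z) ^ 4) ((q : ℂ) ^ 4) ≠ 0)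
    (h₂ : qpoch (-((q : ℂ)⁻¹ ^ 2 * z) ^ 4) ((q : ℂ) ^ 4) ≠ 0) :
    VEqAt q (fun t => y t * gfun q t * wfun q t) z := by
  have hq : (q : ℂ) ≠ 0 := by exact_mod_cast hq0.ne'
  have hqz : (q : ℂ)⁻¹ * z ≠ 0 := mul_ne_zero (inv_ne_zero hq) hz
  have hzz : (q : ℂ)⁻¹ ^ 2 * z = (q : ℂ)⁻¹ * ((q : ℂ)⁻¹ * z) := by ring
  have hyz := hy z
  have e₁ := qpoch_inv_mul hq0 hq1 z
  have e₂ := qpoch_inv_mul hq0 hq1 ((q : ℂ)⁻¹ * z)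
  have g₁ := gfun_inv_mul hq0 hq1 hz
  have g₂ := gfun_inv_mul hq0 hq1 hqz
  rw [← hzz] at e₂ g₂
  unfold VEqAt wfun
  simp only
  rw [e₂] at h₂ ⊢
  rw [e₁] at h₁ h₂ ⊢
  rw [g₂, g₁]
  generalize y ((q : ℂ)⁻¹ ^ 2 * z) = y₂ at *
  generalize y ((q : ℂ)⁻¹ * z) = y₁ at *
  generalize y z = y₀ at *
  generalize gfun q z = G at *
  generalize qpoch (-z ^ 4) ((q : ℂ) ^ 4) = P at *
  have hA : 1 + (q : ℂ)⁻¹ ^ 4 * z ^ 4 ≠ 0 := left_ne_zero_of_mul h₁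
  have hP : P ≠ 0 := right_ne_zero_of_mul h₁
  have hB : 1 + (q : ℂ)⁻¹ ^ 4 * ((q : ℂ)⁻¹ * z) ^ 4 ≠ 0 := left_ne_zero_of_mul h₂
  have hw₂ : ((q : ℂ) ^ 6 * z⁻¹ ^ 4 + (q : ℂ)⁻¹ ^ 2)
      * (-(((q : ℂ)⁻¹ * z) ^ 2 * (q : ℂ)⁻¹ ^ 2) * -(z ^ 2 * (q : ℂ)⁻¹ ^ 2))
      = 1 + (q : ℂ)⁻¹ ^ 4 * ((q : ℂ)⁻¹ * z) ^ 4 := by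
    field_simp
  have hw₁ : ((q : ℂ) * z⁻¹ ^ 2 * (1 + (q : ℂ)) - (q : ℂ)⁻¹ * (1 + (q : ℂ)⁻¹))
      * -(z ^ 2 * (q : ℂ)⁻¹ ^ 2)
      = (q : ℂ)⁻¹ ^ 3 * z ^ 2 * (1 + (q : ℂ)⁻¹) - (1 + (q : ℂ)⁻¹) := by
    field_simp
    ring
  generalize 1 + (q : ℂ)⁻¹ ^ 4 * z ^ 4 = A at *
  generalize 1 + (q : ℂ)⁻¹ ^ 4 * ((q : ℂ)⁻¹ * z) ^ 4 = B at *
  have hB' : B * (B * (A * P))⁻¹ = (A * P)⁻¹ := by field_simp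
  have hA' : A * (A * P)⁻¹ = P⁻¹ := by field_simp
  linear_combination (G * (A * P)⁻¹) * hyz + y₂ * G * (B * (A * P))⁻¹ * hw₂
    + y₁ * G * (A * P)⁻¹ * hw₁ + y₂ * G * hB' - (q : ℂ)⁻¹ * y₀ * G * hA'

lemma summable_of_norm_add_two_le {b : ℕ → ℂ} {δ : ℕ → ℝ} (hδ : Filter.Tendsto δ .atTop (𝓝 0))
    (hb : ∀ j, ‖b (j + 2)‖ ≤ δ j * (‖b (j + 1)‖ + ‖b j‖)) : Summable b := by
  have hs : Summable fun j => ‖b (j + 1)‖ + ‖b j‖ / 4 := by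
    refine summable_of_ratio_norm_eventually_le (r := 1 / 2) (by norm_num) ?_
    filter_upwards [hδ.eventually (ge_mem_nhds (show (0 : ℝ) < 1 / 8 by norm_num))] with j hj
    rw [Real.norm_of_nonneg (by positivity), Real.norm_of_nonneg (by positivity)]
    have h := (hb j).trans (mul_le_mul_of_nonneg_right hj (by positivity))
    have h₁ := norm_nonneg (b (j + 1))
    have h₀ := norm_nonneg (b j)
    rw [show j + 1 + 1 = j + 2 from rfl]
    linarith
  rw [← summable_nat_add_iff 1]
  exact .of_norm_bounded hs fun j => le_add_of_nonneg_right (by positivity)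

lemma summable_mul_pow_of_norm_add_two_le {a : ℕ → ℂ} {ε : ℕ → ℝ}
    (hε : Filter.Tendsto ε .atTop (𝓝 0)) (hε0 : ∀ j, 0 ≤ ε j)
    (ha : ∀ j, ‖a (j + 2)‖ ≤ ε j * (‖a (j + 1)‖ + ‖a j‖)) (x : ℂ) :
    Summable fun j => a j * x ^ j := by
  refine summable_of_norm_add_two_le (δ := fun j => ε j * (‖x‖ + ‖x‖ ^ 2))
    (by simpa using hε.mul_const (‖x‖ + ‖x‖ ^ 2)) fun j => ?_
  simp only [norm_mul, norm_pow]
  have hx := norm_nonneg x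
  calc ‖a (j + 2)‖ * ‖x‖ ^ (j + 2)
      ≤ ε j * (‖a (j + 1)‖ + ‖a j‖) * ‖x‖ ^ (j + 2) := by gcongr; exact ha j
    _ ≤ ε j * (‖a (j + 1)‖ + ‖a j‖) * ‖x‖ ^ (j + 2)
        + ε j * (‖a (j + 1)‖ * ‖x‖ ^ (j + 3) + ‖a j‖ * ‖x‖ ^ (j + 1)) :=
      le_add_of_nonneg_right
        (mul_nonneg (hε0 j) (by positivity))
    _ = _ := by ring

/-- The coefficient of `v_n` in the recurrence obtained by inserting `∑ v_n z⁻ⁿ` into `VEqAt`. -/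
noncomputable def leadCoeff (q : ℝ) (n : ℕ) : ℝ :=
  q⁻¹ ^ 2 * q ^ (2 * n) - q⁻¹ * (1 + q⁻¹) * q ^ n + q⁻¹

/-- The coefficients `v_{2j+s}` of the formal solution of `VEqAt` in powers of `z⁻¹`. -/
noncomputable def vCoeff (q : ℝ) (s : ℕ) : ℕ → ℝ
  | 0 => 1
  | 1 => -(q * (1 + q) * q ^ s) / leadCoeff q (2 + s)
  | j + 2 => -(q * (1 + q) * q ^ (2 * (j + 1) + s) * vCoeff q s (j + 1)
      + q ^ 6 * q ^ (2 * (2 * j + s)) * vCoeff q s j) / leadCoeff q (2 * (j + 2) + s)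

lemma leadCoeff_ge {q : ℝ} (hq0 : 0 < q) (hq1 : q < 1) (n : ℕ) :
    (1 - q) ^ 2 ≤ leadCoeff q (n + 2) := by
  have h : leadCoeff q (n + 2) = q⁻¹ * ((1 - q ^ (n + 1)) * (1 - q ^ (n + 2))) := by
    unfold leadCoeff
    field_simp
    ring
  have h₁ : q ^ (n + 1) ≤ q := pow_le_of_le_one hq0.le hq1.le (by omega)
  have h₂ : q ^ (n + 2) ≤ q := pow_le_of_le_one hq0.le hq1.le (by omega)
  have h₃ : (1 - q) ^ 2 ≤ (1 - q ^ (n + 1)) * (1 - q ^ (n + 2)) := by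
    rw [sq]
    exact mul_le_mul (by linarith) (by linarith) (by linarith) (by linarith)
  rw [h]
  exact h₃.trans (le_mul_of_one_le_left ((sq_nonneg _).trans h₃) ((one_le_inv₀ hq0).2 hq1.le))

lemma leadCoeff_ne_zero {q : ℝ} (hq0 : 0 < q) (hq1 : q < 1) (n : ℕ) :
    leadCoeff q (n + 2) ≠ 0 :=
  (lt_of_lt_of_le (pow_pos (sub_pos.2 hq1) 2) (leadCoeff_ge hq0 hq1 n)).ne'

lemma abs_vCoeff_add_two_le {q : ℝ} (hq0 : 0 < q) (hq1 : q < 1) (s j : ℕ) :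
    |vCoeff q s (j + 2)| ≤ 2 / (1 - q) ^ 2 * q ^ j * (|vCoeff q s (j + 1)| + |vCoeff q s j|) := by
  have hL := leadCoeff_ge hq0 hq1 (2 * (j + 1) + s)
  rw [show 2 * (j + 1) + s + 2 = 2 * (j + 2) + s by ring] at hL
  have hq : 0 < (1 - q) ^ 2 := pow_pos (sub_pos.2 hq1) 2
  have h₁ : q * (1 + q) * q ^ (2 * (j + 1) + s) ≤ 2 * q ^ j := by
    have : q ^ (2 * (j + 1) + s) ≤ q ^ j := pow_le_pow_of_le_one hq0.le hq1.le (by omega)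
    exact mul_le_mul (by nlinarith) this (by positivity) (by norm_num)
  have h₀ : q ^ 6 * q ^ (2 * (2 * j + s)) ≤ 2 * q ^ j := by
    rw [← pow_add]
    have : q ^ (6 + 2 * (2 * j + s)) ≤ q ^ j := pow_le_pow_of_le_one hq0.le hq1.le (by omega)
    linarith [pow_pos hq0 j]
  rw [vCoeff, abs_div, abs_neg, abs_of_pos (hq.trans_le hL), div_le_iff₀ (hq.trans_le hL)]
  calc |q * (1 + q) * q ^ (2 * (j + 1) + s) * vCoeff q s (j + 1)
        + q ^ 6 * q ^ (2 * (2 * j + s)) * vCoeff q s j|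
      ≤ q * (1 + q) * q ^ (2 * (j + 1) + s) * |vCoeff q s (j + 1)|
        + q ^ 6 * q ^ (2 * (2 * j + s)) * |vCoeff q s j| := by
        refine (abs_add_le _ _).trans_eq ?_
        rw [abs_mul, abs_mul (q ^ 6 * _), abs_of_pos (by positivity : 0 < q * (1 + q) * _),
          abs_of_pos (by positivity : 0 < q ^ 6 * q ^ (2 * (2 * j + s)))]
    _ ≤ 2 * q ^ j * |vCoeff q s (j + 1)| + 2 * q ^ j * |vCoeff q s j| := by gcongr
    _ = 2 / (1 - q) ^ 2 * q ^ j * (|vCoeff q s (j + 1)| + |vCoeff q s j|) * (1 - q) ^ 2 := by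
        field_simp [(sub_pos.2 hq1).ne']
    _ ≤ _ := by gcongr

lemma summable_vCoeff_mul_pow {q : ℝ} (hq0 : 0 < q) (hq1 : q < 1) (s : ℕ) (x : ℂ) :
    Summable fun j => (vCoeff q s j : ℂ) * x ^ j := by
  refine summable_mul_pow_of_norm_add_two_le (ε := fun j => 2 / (1 - q) ^ 2 * q ^ j) ?_
    (fun j => by positivity) (fun j => ?_) x
  · simpa using (tendsto_pow_atTop_nhds_zero_of_lt_one hq0.le hq1).const_mul (2 / (1 - q) ^ 2)
  · simpa only [Complex.norm_real, Real.norm_eq_abs] using abs_vCoeff_add_two_le hq0 hq1 s j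

lemma summable_vCoeff_mul_inv_pow {q : ℝ} (hq0 : 0 < q) (hq1 : q < 1) (s : ℕ) (z : ℂ) :
    Summable fun j => (vCoeff q s j : ℂ) * z⁻¹ ^ (2 * j + s) := by
  refine ((summable_vCoeff_mul_pow hq0 hq1 s (z⁻¹ ^ 2)).mul_right (z⁻¹ ^ s)).congr fun j => ?_
  ring

lemma vEqAt_tsum_vCoeff {q : ℝ} (hq0 : 0 < q) (hq1 : q < 1) {s : ℕ}
    (hs : leadCoeff q s = 0) (z : ℂ) :
    VEqAt q (fun t => ∑' j : ℕ, (vCoeff q s j : ℂ) * t⁻¹ ^ (2 * j + s)) z := by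
  have hS := fun t => summable_vCoeff_mul_inv_pow hq0 hq1 s t
  have split₁ := fun t => (hS t).sum_add_tsum_nat_add 1
  have split₂ := fun t => (hS t).sum_add_tsum_nat_add 2
  have hS₁ := fun t => (summable_nat_add_iff 1).2 (hS t)
  have hS₂ := fun t => (summable_nat_add_iff 2).2 (hS t)
  set z₁ := (q : ℂ)⁻¹ * z with hz₁
  set z₂ := (q : ℂ)⁻¹ ^ 2 * z with hz₂
  have hrec : ∀ j : ℕ,
      (q : ℂ) ^ 6 * z⁻¹ ^ 4 * ((vCoeff q s j : ℂ) * z₂⁻¹ ^ (2 * j + s))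
      + (q : ℂ)⁻¹ ^ 2 * ((vCoeff q s (j + 2) : ℂ) * z₂⁻¹ ^ (2 * (j + 2) + s))
      + (q : ℂ) * z⁻¹ ^ 2 * (1 + (q : ℂ))
        * ((vCoeff q s (j + 1) : ℂ) * z₁⁻¹ ^ (2 * (j + 1) + s))
      - (q : ℂ)⁻¹ * (1 + (q : ℂ)⁻¹)
        * ((vCoeff q s (j + 2) : ℂ) * z₁⁻¹ ^ (2 * (j + 2) + s))
      + (q : ℂ)⁻¹ * ((vCoeff q s (j + 2) : ℂ) * z⁻¹ ^ (2 * (j + 2) + s)) = 0 := by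
    intro j
    have h : vCoeff q s (j + 2) * leadCoeff q (2 * (j + 2) + s)
        = -(q * (1 + q) * q ^ (2 * (j + 1) + s) * vCoeff q s (j + 1)
          + q ^ 6 * q ^ (2 * (2 * j + s)) * vCoeff q s j) := by
      rw [vCoeff, div_mul_cancel₀]
      have := leadCoeff_ne_zero hq0 hq1 (2 * (j + 1) + s)
      rwa [show 2 * (j + 1) + s + 2 = 2 * (j + 2) + s by ring] at this
    have h' := congrArg (fun r : ℝ => (r : ℂ)) h
    simp only [leadCoeff] at h'
    push_cast at h'
    simp only [hz₁, hz₂, mul_inv, inv_pow, inv_inv, mul_pow] at h' ⊢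
    linear_combination z⁻¹ ^ (2 * (j + 2) + s) * h'
  have hzero : (q : ℂ)⁻¹ ^ 2 * ((vCoeff q s 0 : ℂ) * z₂⁻¹ ^ (2 * 0 + s))
      - (q : ℂ)⁻¹ * (1 + (q : ℂ)⁻¹) * ((vCoeff q s 0 : ℂ) * z₁⁻¹ ^ (2 * 0 + s))
      + (q : ℂ)⁻¹ * ((vCoeff q s 0 : ℂ) * z⁻¹ ^ (2 * 0 + s)) = 0 := by
    have h' := congrArg (fun r : ℝ => (r : ℂ)) hs
    simp only [leadCoeff] at h'
    push_cast at h'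
    simp only [hz₁, hz₂, mul_inv, inv_pow, inv_inv, mul_pow] at h' ⊢
    linear_combination (vCoeff q s 0 : ℂ) * z⁻¹ ^ s * h'
  have hone : (q : ℂ)⁻¹ ^ 2 * ((vCoeff q s 1 : ℂ) * z₂⁻¹ ^ (2 * 1 + s))
      + (q : ℂ) * z⁻¹ ^ 2 * (1 + (q : ℂ)) * ((vCoeff q s 0 : ℂ) * z₁⁻¹ ^ (2 * 0 + s))
      - (q : ℂ)⁻¹ * (1 + (q : ℂ)⁻¹) * ((vCoeff q s 1 : ℂ) * z₁⁻¹ ^ (2 * 1 + s))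
      + (q : ℂ)⁻¹ * ((vCoeff q s 1 : ℂ) * z⁻¹ ^ (2 * 1 + s)) = 0 := by
    have h : vCoeff q s 1 * leadCoeff q (s + 2) = -(q * (1 + q) * q ^ s) * vCoeff q s 0 := by
      rw [vCoeff, vCoeff, add_comm 2 s, div_mul_cancel₀ _ (leadCoeff_ne_zero hq0 hq1 s), mul_one]
    have h' := congrArg (fun r : ℝ => (r : ℂ)) h
    simp only [leadCoeff] at h'
    push_cast at h'
    simp only [hz₁, hz₂, mul_inv, inv_pow, inv_inv, mul_pow] at h' ⊢
    linear_combination z⁻¹ ^ (s + 2) * h'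
  have hsum := (((((hS z₂).hasSum.mul_left ((q : ℂ) ^ 6 * z⁻¹ ^ 4)).add
    ((hS₂ z₂).hasSum.mul_left ((q : ℂ)⁻¹ ^ 2))).add
    ((hS₁ z₁).hasSum.mul_left ((q : ℂ) * z⁻¹ ^ 2 * (1 + (q : ℂ))))).sub
    ((hS₂ z₁).hasSum.mul_left ((q : ℂ)⁻¹ * (1 + (q : ℂ)⁻¹)))).add
    ((hS₂ z).hasSum.mul_left (q : ℂ)⁻¹)
  simp only [hrec] at hsum
  have htail := hsum.unique hasSum_zero
  simp only [Finset.sum_range_succ, Finset.sum_range_zero, zero_add] at split₁ split₂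
  unfold VEqAt
  simp only
  rw [← hz₁, ← hz₂]
  linear_combination htail + hzero + hone
    - (q : ℂ)⁻¹ ^ 2 * split₂ z₂
    - (q : ℂ) * z⁻¹ ^ 2 * (1 + (q : ℂ)) * split₁ z₁
    + (q : ℂ)⁻¹ * (1 + (q : ℂ)⁻¹) * split₂ z₁
    - (q : ℂ)⁻¹ * split₂ z

theorem statement5 (q : ℝ) (hq0 : 0 < q) (hq1 : q < 1) :
    -- (a)
    (∀ y : ℂ → ℂ, NearEq q y →
      ∀ z : ℂ, z ≠ 0 →
        qpoch (-z ^ 4) ((q : ℂ) ^ 4) ≠ 0 →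
        qpoch (-((q : ℂ)⁻¹ * z) ^ 4) ((q : ℂ) ^ 4) ≠ 0 →
        qpoch (-((q : ℂ)⁻¹ ^ 2 * z) ^ 4) ((q : ℂ) ^ 4) ≠ 0 →
        VEqAt q (fun t => y t * gfun q t * wfun q t) z) ∧
    -- (b)
    (∃ ce co : ℕ → ℂ,
      ce 0 = 1 ∧ co 0 = 1 ∧
      (∀ z : ℂ, z ≠ 0 →
        Summable (fun j : ℕ => ce j * z⁻¹ ^ (2 * j)) ∧
        Summable (fun j : ℕ => co j * z⁻¹ ^ (2 * j + 1))) ∧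
      (∀ z : ℂ, z ≠ 0 → VEqAt q (fun t => ∑' j : ℕ, ce j * t⁻¹ ^ (2 * j)) z) ∧
      (∀ z : ℂ, z ≠ 0 → VEqAt q (fun t => ∑' j : ℕ, co j * t⁻¹ ^ (2 * j + 1)) z)) := by
  refine ⟨fun y hy z hz _ h₁ h₂ => hy.vEqAt hq0 hq1 hz h₁ h₂,
    fun j => vCoeff q 0 j, fun j => vCoeff q 1 j, by simp [vCoeff], by simp [vCoeff],
    fun z _ => ⟨summable_vCoeff_mul_inv_pow hq0 hq1 0 z, summable_vCoeff_mul_inv_pow hq0 hq1 1 z⟩,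
    fun z _ => vEqAt_tsum_vCoeff hq0 hq1 ?_ z, fun z _ => vEqAt_tsum_vCoeff hq0 hq1 ?_ z⟩
  · simp only [leadCoeff]
    ring
  · simp only [leadCoeff]
    field_simp
    ring
end

section
/- There exists a function a_∞, analytic on ℂ ∖ {0} and given by an everywhere-convergent even power series a_∞(t) = Σ_{j=0}^{∞} a_{2j} t^{−2j} with a_0 = 1, satisfying q⁷ t^{−4} a_∞(q^{−2} t) − (1 − q²(q+1) t^{−2}) a_∞(q^{−1} t) + a_∞(t) = 0 for all t ∈ ℂ ∖ {0}. Similarly there exists a function b_∞, analytic on ℂ ∖ {0} and given by an everywhere-convergent odd power series b_∞(t) = Σ_{j=0}^{∞} b_{2j+1} t^{−2j−1} with b_1 = 1, satisfying q⁷ t^{−4} b_∞(q^{−2} t) − (q^{−1} − q²(q+1) t^{−2}) b_∞(q^{−1} t) + b_∞(t) = 0 for all t ∈ ℂ ∖ {0}. -/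
open Complex Topology

/-- The coefficients `c j` of the entire solution `A` of
`q ^ 7 * x ^ 2 * A (q ^ 4 * x) - (1 - q ^ 2 * (q + 1) * x) * A (q ^ 2 * x) + A x = 0`
with `A 0 = 1`. -/
noncomputable def qCoeff (q : ℝ) : ℕ → ℝ
  | 0 => 1
  | 1 => -((q + 1) * q ^ 2) / (1 - q ^ 2)
  | j + 2 => -(q ^ (4 * j + 7) * qCoeff q j + (q + 1) * q ^ (2 * j + 4) * qCoeff q (j + 1)) /
      (1 - q ^ (2 * j + 4))

theorem summable_of_two_step_le {d : ℕ → ℝ} (hd : ∀ j, 0 ≤ d j)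
    (h : ∀ᶠ j in Filter.atTop, d (j + 2) ≤ 1 / 8 * (d j + d (j + 1))) : Summable d := by
  have he : Summable fun j => d j + 2 * d (j + 1) := by
    refine summable_of_ratio_norm_eventually_le (r := 5 / 8) (by norm_num) ?_
    filter_upwards [h] with j hj
    have h0 := hd j
    have h1 := hd (j + 1)
    have h2 := hd (j + 2)
    rw [Real.norm_of_nonneg (by positivity), Real.norm_of_nonneg (by positivity)]
    linarith
  exact he.of_nonneg_of_le hd fun j => by linarith [hd (j + 1)]

theorem abs_qCoeff_add_two_le {q : ℝ} (hq0 : 0 < q) (hq1 : q < 1) (j : ℕ) :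
    |qCoeff q (j + 2)| ≤ 2 / (1 - q) * q ^ j * (|qCoeff q j| + |qCoeff q (j + 1)|) := by
  have hpow : ∀ {m n : ℕ}, n ≤ m → q ^ m ≤ q ^ n :=
    fun h => pow_le_pow_of_le_one hq0.le hq1.le h
  have hden : 1 - q ≤ 1 - q ^ (2 * j + 4) := by
    linarith [pow_one q ▸ hpow (m := 2 * j + 4) (n := 1) (by omega)]
  have hq : 0 < 1 - q := by linarith
  have hnum : |-(q ^ (4 * j + 7) * qCoeff q j + (q + 1) * q ^ (2 * j + 4) * qCoeff q (j + 1))| ≤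
      2 * q ^ j * (|qCoeff q j| + |qCoeff q (j + 1)|) := by
    rw [abs_neg]
    refine (abs_add_le _ _).trans ?_
    rw [abs_mul, abs_mul, abs_of_pos (by positivity : 0 < q ^ (4 * j + 7)),
      abs_of_pos (by positivity : 0 < (q + 1) * q ^ (2 * j + 4)), mul_add]
    have hj : 0 < q ^ j := by positivity
    gcongr ?_ * _ + ?_ * _
    · linarith [hpow (m := 4 * j + 7) (n := j) (by omega)]
    · exact mul_le_mul (by linarith) (hpow (by omega)) (by positivity) (by norm_num)
  rw [qCoeff, abs_div, abs_of_pos (by linarith : 0 < 1 - q ^ (2 * j + 4))]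
  calc _ ≤ 2 * q ^ j * (|qCoeff q j| + |qCoeff q (j + 1)|) / (1 - q) := by gcongr
    _ = _ := by ring

theorem summable_qCoeff_mul_pow {q : ℝ} (hq0 : 0 < q) (hq1 : q < 1) (x : ℂ) :
    Summable fun j => (qCoeff q j : ℂ) * x ^ j := by
  refine Summable.of_norm (summable_of_two_step_le (fun j => norm_nonneg _) ?_)
  set R := ‖x‖
  have hR : 0 ≤ R := norm_nonneg x
  have hlim : Filter.Tendsto (fun j : ℕ => 2 / (1 - q) * q ^ j * (R ^ 2 + R))
      Filter.atTop (𝓝 0) := by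
    simpa using ((tendsto_pow_atTop_nhds_zero_of_lt_one hq0.le hq1).const_mul
      (2 / (1 - q))).mul_const (R ^ 2 + R)
  filter_upwards [hlim.eventually_le_const (by norm_num : (0 : ℝ) < 1 / 8)] with j hj
  simp only [norm_mul, norm_pow, Complex.norm_real, Real.norm_eq_abs]
  have hq : 0 < 1 - q := by linarith
  set k := 2 / (1 - q) * q ^ j
  have hk : 0 ≤ k := by positivity
  have hk1 : k * R ^ 2 ≤ 1 / 8 := by nlinarith [mul_nonneg hk hR]
  have hk2 : k * R ≤ 1 / 8 := by nlinarith [mul_nonneg hk (sq_nonneg R)]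
  calc |qCoeff q (j + 2)| * R ^ (j + 2)
      ≤ k * (|qCoeff q j| + |qCoeff q (j + 1)|) * R ^ (j + 2) := by
        gcongr
        exact abs_qCoeff_add_two_le hq0 hq1 j
    _ = k * R ^ 2 * (|qCoeff q j| * R ^ j) + k * R * (|qCoeff q (j + 1)| * R ^ (j + 1)) := by
        ring
    _ ≤ 1 / 8 * (|qCoeff q j| * R ^ j) + 1 / 8 * (|qCoeff q (j + 1)| * R ^ (j + 1)) := by
        gcongr
    _ = _ := by ring

theorem qCoeff_one_mul {q : ℝ} (hq0 : 0 < q) (hq1 : q < 1) :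
    (qCoeff q 1 : ℂ) * (1 - (q : ℂ) ^ 2) = -(((q : ℂ) + 1) * (q : ℂ) ^ 2) := by
  have h : 1 - q ^ 2 ≠ 0 := by nlinarith
  exact_mod_cast show qCoeff q 1 * (1 - q ^ 2) = -((q + 1) * q ^ 2) by
    rw [qCoeff, div_mul_cancel₀ _ h]

theorem qCoeff_add_two_mul {q : ℝ} (hq0 : 0 < q) (hq1 : q < 1) (j : ℕ) :
    (qCoeff q (j + 2) : ℂ) * (1 - (q : ℂ) ^ (2 * j + 4)) =
      -((q : ℂ) ^ (4 * j + 7) * qCoeff q j +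
        ((q : ℂ) + 1) * (q : ℂ) ^ (2 * j + 4) * qCoeff q (j + 1)) := by
  have h : 1 - q ^ (2 * j + 4) ≠ 0 :=
    (sub_pos.2 (pow_lt_one₀ hq0.le hq1 (by omega))).ne'
  exact_mod_cast show qCoeff q (j + 2) * (1 - q ^ (2 * j + 4)) =
      -(q ^ (4 * j + 7) * qCoeff q j + (q + 1) * q ^ (2 * j + 4) * qCoeff q (j + 1)) by
    rw [qCoeff, div_mul_cancel₀ _ h]

theorem qCoeff_functional_equation {q : ℝ} (hq0 : 0 < q) (hq1 : q < 1) (x : ℂ) :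
    (q : ℂ) ^ 7 * x ^ 2 * (∑' j, (qCoeff q j : ℂ) * ((q : ℂ) ^ 4 * x) ^ j)
      - (1 - (q : ℂ) ^ 2 * ((q : ℂ) + 1) * x) * (∑' j, (qCoeff q j : ℂ) * ((q : ℂ) ^ 2 * x) ^ j)
      + (∑' j, (qCoeff q j : ℂ) * x ^ j) = 0 := by
  have hs := summable_qCoeff_mul_pow hq0 hq1
  set Q : ℂ := (q : ℂ)
  have h4 := (hs (Q ^ 4 * x)).hasSum
  have h2 := (hs (Q ^ 2 * x)).hasSum
  have h2' := (hasSum_nat_add_iff' 1).2 h2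
  have h2'' := (hasSum_nat_add_iff' 2).2 h2
  have h1 := (hasSum_nat_add_iff' 2).2 (hs x).hasSum
  have hall := (((h4.mul_left (Q ^ 7 * x ^ 2)).sub h2'').add
    (h2'.mul_left (Q ^ 2 * (Q + 1) * x))).add h1
  have hterm : ∀ j : ℕ, Q ^ 7 * x ^ 2 * ((qCoeff q j : ℂ) * (Q ^ 4 * x) ^ j)
      - (qCoeff q (j + 2) : ℂ) * (Q ^ 2 * x) ^ (j + 2)
      + Q ^ 2 * (Q + 1) * x * ((qCoeff q (j + 1) : ℂ) * (Q ^ 2 * x) ^ (j + 1))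
      + (qCoeff q (j + 2) : ℂ) * x ^ (j + 2) = 0 := fun j => by
    linear_combination x ^ (j + 2) * qCoeff_add_two_mul hq0 hq1 j
  have hzero := hall.unique (by simpa only [hterm] using hasSum_zero)
  have hc0 : (qCoeff q 0 : ℂ) = 1 := by simp [qCoeff]
  simp only [Finset.sum_range_succ, Finset.sum_range_zero, hc0] at hzero
  linear_combination hzero + x * qCoeff_one_mul hq0 hq1


theorem statement7 (q : ℝ) (hq0 : 0 < q) (hq1 : q < 1) :
    -- even solution a_∞
    (∃ ca : ℕ → ℂ,
      ca 0 = 1 ∧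
      (∀ t : ℂ, t ≠ 0 → Summable (fun j : ℕ => ca j * t⁻¹ ^ (2 * j))) ∧
      (∀ t : ℂ, t ≠ 0 →
        (q : ℂ) ^ 7 * t⁻¹ ^ 4 * (∑' j : ℕ, ca j * ((q : ℂ)⁻¹ ^ 2 * t)⁻¹ ^ (2 * j))
          - (1 - (q : ℂ) ^ 2 * ((q : ℂ) + 1) * t⁻¹ ^ 2) *
              (∑' j : ℕ, ca j * ((q : ℂ)⁻¹ * t)⁻¹ ^ (2 * j))
          + (∑' j : ℕ, ca j * t⁻¹ ^ (2 * j)) = 0)) ∧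
    -- odd solution b_∞
    (∃ cb : ℕ → ℂ,
      cb 0 = 1 ∧
      (∀ t : ℂ, t ≠ 0 → Summable (fun j : ℕ => cb j * t⁻¹ ^ (2 * j + 1))) ∧
      (∀ t : ℂ, t ≠ 0 →
        (q : ℂ) ^ 7 * t⁻¹ ^ 4 * (∑' j : ℕ, cb j * ((q : ℂ)⁻¹ ^ 2 * t)⁻¹ ^ (2 * j + 1))
          - ((q : ℂ)⁻¹ - (q : ℂ) ^ 2 * ((q : ℂ) + 1) * t⁻¹ ^ 2) *
              (∑' j : ℕ, cb j * ((q : ℂ)⁻¹ * t)⁻¹ ^ (2 * j + 1))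
          + (∑' j : ℕ, cb j * t⁻¹ ^ (2 * j + 1)) = 0)) := by
  have hs := summable_qCoeff_mul_pow hq0 hq1
  have hQ : (q : ℂ) ≠ 0 := by exact_mod_cast hq0.ne'
  have hodd : ∀ s : ℂ, (fun j : ℕ => (q : ℂ) ^ j * (qCoeff q j : ℂ) * s ^ (2 * j + 1)) =
      fun j => s * ((qCoeff q j : ℂ) * ((q : ℂ) * s ^ 2) ^ j) := fun s => by
    funext j
    rw [mul_pow, ← pow_mul, pow_succ]
    ring
  refine ⟨⟨fun j => qCoeff q j, by simp [qCoeff], fun t _ => ?_, fun t _ => ?_⟩,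
    ⟨fun j => (q : ℂ) ^ j * qCoeff q j, by simp [qCoeff], fun t _ => ?_, fun t _ => ?_⟩⟩
  · simpa only [pow_mul] using hs (t⁻¹ ^ 2)
  · have h := qCoeff_functional_equation hq0 hq1 (t⁻¹ ^ 2)
    simp only [pow_mul, mul_inv, inv_pow, inv_inv, mul_pow] at h ⊢
    simp only [← pow_mul] at h ⊢
    linear_combination h
  · rw [hodd]
    exact (hs _).mul_left _
  · have h := qCoeff_functional_equation hq0 hq1 ((q : ℂ) * t⁻¹ ^ 2)
    simp only [hodd, tsum_mul_left]
    have e2 : (q : ℂ) * (((q : ℂ)⁻¹ ^ 2 * t)⁻¹) ^ 2 = (q : ℂ) ^ 4 * ((q : ℂ) * t⁻¹ ^ 2) := by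
      simp only [mul_inv, inv_pow, inv_inv]
      ring
    have e1 : (q : ℂ) * (((q : ℂ)⁻¹ * t)⁻¹) ^ 2 = (q : ℂ) ^ 2 * ((q : ℂ) * t⁻¹ ^ 2) := by
      simp only [mul_inv, inv_inv]
      ring
    have e3 : ((q : ℂ)⁻¹ ^ 2 * t)⁻¹ = (q : ℂ) ^ 2 * t⁻¹ := by
      rw [mul_inv, inv_pow, inv_inv]
    rw [e1, e2, e3, mul_inv, inv_inv]
    generalize (∑' j, (qCoeff q j : ℂ) * ((q : ℂ) ^ 2 * ((q : ℂ) * t⁻¹ ^ 2)) ^ j) = B at h ⊢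
    linear_combination t⁻¹ * h - t⁻¹ * B * inv_mul_cancel₀ hQ
end

section
/- Let C be a function analytic on ℂ ∖ ({0} ∪ {q^k : k ∈ ℤ} ∪ {−q^k : k ∈ ℤ}) with at most simple poles at the points ±q^k (k ∈ ℤ), and suppose C(qz) = C(z) for all z in its domain. Then there exist constants c₀, c₁ ∈ ℂ such that C(z) = c₁ h_q(z) + c₀ for all z in the domain. -/
open Complex Topology

open Set Metric Filter

/-- The open annulus `a < |z| < a⁻¹`. -/
def symmAnnulus (a : ℝ) : Set ℂ := {z | a < ‖z‖ ∧ ‖z‖ < a⁻¹}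

theorem isOpen_symmAnnulus (a : ℝ) : IsOpen (symmAnnulus a) :=
  (isOpen_lt continuous_const continuous_norm).inter (isOpen_lt continuous_norm continuous_const)

theorem isPreconnected_symmAnnulus {a : ℝ} (ha : 0 < a) : IsPreconnected (symmAnnulus a) := by
  have h : symmAnnulus a = Complex.exp '' (Complex.re ⁻¹' Ioo (Real.log a) (Real.log a⁻¹)) := by
    ext z
    simp only [symmAnnulus, mem_ofPred_eq, mem_image, mem_preimage, mem_Ioo]
    constructor
    · rintro ⟨h1, h2⟩
      have hz : 0 < ‖z‖ := ha.trans h1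
      refine ⟨Complex.log z, ?_, Complex.exp_log (norm_pos_iff.1 hz)⟩
      rw [Complex.log_re]
      exact ⟨Real.log_lt_log ha h1, Real.log_lt_log hz h2⟩
    · rintro ⟨w, ⟨h1, h2⟩, rfl⟩
      rw [Complex.norm_exp]
      exact ⟨(Real.log_lt_iff_lt_exp ha).1 h1, (Real.lt_log_iff_exp_lt (inv_pos.2 ha)).1 h2⟩
  rw [h]
  refine IsPreconnected.image ?_ _ Complex.continuous_exp.continuousOn
  exact ((convex_Ioo _ _).linear_preimage Complex.reLm).isPreconnected

/-- Subtracting the principal part at a simple pole extends the function holomorphically. -/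
theorem exists_differentiableOn_sub_principalPart {S : Set ℂ} (hS : IsOpen S) {c : ℂ} (hc : c ∈ S)
    {f g : ℂ → ℂ} (hf : DifferentiableOn ℂ f (S \ {c})) (hg : AnalyticAt ℂ g c)
    (hfg : ∀ᶠ z in 𝓝[≠] c, f z = g z / (z - c)) :
    ∃ F : ℂ → ℂ, DifferentiableOn ℂ F S ∧ ∀ z ≠ c, F z = f z - g c / (z - c) := by
  classical
  refine ⟨Function.update (fun z => f z - g c / (z - c)) c (deriv g c), ?_, fun z hz => by
    simp [hz]⟩
  intro z hz
  apply DifferentiableAt.differentiableWithinAt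
  by_cases h : z = c
  · subst h
    obtain ⟨p, hp⟩ := hg
    have hd : AnalyticAt ℂ (dslope g z) z := ⟨_, hp.has_fpower_series_dslope_fslope⟩
    refine hd.differentiableAt.congr_of_eventuallyEq ?_
    rw [eventually_nhdsWithin_iff] at hfg
    filter_upwards [hfg] with w hw
    by_cases hwz : w = z
    · subst hwz; simp
    · rw [Function.update_of_ne hwz, dslope_of_ne _ hwz, hw hwz, slope_def_field, sub_div]
  · have ho : IsOpen (S \ {c}) := hS.sdiff isClosed_singleton
    have hfz : DifferentiableAt ℂ f z := hf.differentiableAt (ho.mem_nhds ⟨hz, h⟩)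
    have h2 : DifferentiableAt ℂ (fun z => f z - g c / (z - c)) z :=
      hfz.sub ((differentiableAt_const _).div (by fun_prop) (sub_ne_zero.2 h))
    refine h2.congr_of_eventuallyEq ?_
    filter_upwards [isOpen_ne.mem_nhds h] with w hw
    rw [Function.update_of_ne hw]

theorem hqfun_mul {q : ℝ} (hq : q ≠ 0) (z : ℂ) : hqfun q (q * z) = hqfun q z := by
  have hq' : (q : ℂ) ≠ 0 := by exact_mod_cast hq
  unfold hqfun
  rw [← (Equiv.addRight (1 : ℤ)).tsum_eq]
  refine tsum_congr fun k => ?_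
  simp only [Equiv.coe_addRight]
  have h1 : (q : ℂ) ^ (k + 1) = q ^ k * q := zpow_add_one₀ hq' k
  have h2 : (q : ℂ) ^ (2 * (k + 1)) = q ^ (2 * k) * q ^ 2 := by
    rw [mul_add, zpow_add₀ hq']; norm_cast
  rw [h1, h2, show 2 * (q * z) * ((q : ℂ) ^ k * q) = q ^ 2 * (2 * z * q ^ k) by ring,
    show ((q * z : ℂ)) ^ 2 - (q : ℂ) ^ (2 * k) * q ^ 2 = q ^ 2 * (z ^ 2 - q ^ (2 * k)) by ring,
    mul_div_mul_left _ _ (pow_ne_zero 2 hq')]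

theorem summable_pow_natAbs {q : ℝ} (hq0 : 0 < q) (hq1 : q < 1) :
    Summable fun k : ℤ => q ^ k.natAbs := by
  have h := summable_geometric_of_lt_one hq0.le hq1
  exact summable_int_iff_summable_nat_and_neg.2 ⟨by simpa using h, by simpa using h⟩

theorem sub_sq_le_norm_sq_sub {q a : ℝ} (hq0 : 0 < q) (hq1 : q < 1) {w : ℂ} (ha : 0 < a)
    (hw : a < ‖w‖) {n : ℕ} (hn : n ≠ 0) : a ^ 2 - q ^ 2 ≤ ‖w ^ 2 - (q : ℂ) ^ (2 * n)‖ := by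
  have h1 : ‖w ^ 2‖ - ‖(q : ℂ) ^ (2 * n)‖ ≤ ‖w ^ 2 - (q : ℂ) ^ (2 * n)‖ := norm_sub_norm_le _ _
  rw [norm_pow, norm_pow, Complex.norm_real, Real.norm_of_nonneg hq0.le] at h1
  have h2 : q ^ (2 * n) ≤ q ^ 2 := pow_le_pow_of_le_one hq0.le hq1.le (by omega)
  have h3 : a ^ 2 ≤ ‖w‖ ^ 2 := by gcongr
  linarith

/-- The terms with `k ≠ 0` of the series for `hqfun` in a form suited to estimates. -/
theorem exists_bound_hqfun_term {q a : ℝ} (hq0 : 0 < q) (hqa : q < a) (ha1 : a < 1) {k : ℤ}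
    (hk : k ≠ 0) {z : ℂ} (hz : z ∈ symmAnnulus a) :
    z ^ 2 - (q : ℂ) ^ (2 * k) ≠ 0 ∧
    ‖2 * z * (q : ℂ) ^ k / (z ^ 2 - (q : ℂ) ^ (2 * k))‖ ≤
      2 * a⁻¹ / (a ^ 2 - q ^ 2) * q ^ k.natAbs := by
  have ha0 : 0 < a := hq0.trans hqa
  have hq1 : q < 1 := hqa.trans ha1
  have hq' : (q : ℂ) ≠ 0 := by exact_mod_cast hq0.ne'
  have hpos : 0 < a ^ 2 - q ^ 2 := by nlinarith
  obtain ⟨h1, h2⟩ := hz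
  have hz0 : z ≠ 0 := norm_pos_iff.1 (ha0.trans h1)
  obtain ⟨n, rfl | rfl⟩ := k.eq_nat_or_neg
  · have hn : n ≠ 0 := by omega
    have hb := sub_sq_le_norm_sq_sub hq0 hq1 ha0 h1 hn
    have he : (q : ℂ) ^ (2 * (n : ℤ)) = (q : ℂ) ^ (2 * n) := by norm_cast
    rw [he, zpow_natCast, Int.natAbs_natCast]
    refine ⟨norm_pos_iff.1 (hpos.trans_le hb), ?_⟩
    rw [norm_div, norm_mul, norm_mul, norm_pow, Complex.norm_real, Real.norm_of_nonneg hq0.le,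
      Complex.norm_ofNat, mul_div_right_comm]
    gcongr
  · have hn : n ≠ 0 := by omega
    have hw : a < ‖z⁻¹‖ := by
      rw [norm_inv]; exact (lt_inv_comm₀ ha0 (ha0.trans h1)).2 h2
    have hw' : ‖z⁻¹‖ ≤ a⁻¹ := by
      rw [norm_inv]; gcongr
    have hb := sub_sq_le_norm_sq_sub hq0 hq1 ha0 hw hn
    have hne := norm_pos_iff.1 (hpos.trans_le hb)
    have he : (q : ℂ) ^ (2 * -(n : ℤ)) = ((q : ℂ) ^ (2 * n))⁻¹ := by
      rw [mul_neg, zpow_neg]; norm_cast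
    have hqn : (q : ℂ) ^ n ≠ 0 := pow_ne_zero _ hq'
    have hd : z ^ 2 - ((q : ℂ) ^ (2 * n))⁻¹ =
        -(z ^ 2 * ((q : ℂ) ^ (2 * n))⁻¹) * (z⁻¹ ^ 2 - (q : ℂ) ^ (2 * n)) := by
      rw [pow_mul']
      field_simp
      ring
    rw [he, zpow_neg, zpow_natCast, Int.natAbs_neg, Int.natAbs_natCast]
    have hD : z ^ 2 - ((q : ℂ) ^ (2 * n))⁻¹ ≠ 0 := by
      rw [hd]
      exact mul_ne_zero (neg_ne_zero.2 (mul_ne_zero (pow_ne_zero _ hz0)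
        (inv_ne_zero (pow_ne_zero _ hq')))) hne
    refine ⟨hD, ?_⟩
    have ht : 2 * z * ((q : ℂ) ^ n)⁻¹ / (z ^ 2 - ((q : ℂ) ^ (2 * n))⁻¹) =
        -(2 * z⁻¹ * (q : ℂ) ^ n / (z⁻¹ ^ 2 - (q : ℂ) ^ (2 * n))) := by
      rw [← neg_div, div_eq_div_iff hD hne, hd, pow_mul']
      field_simp
    rw [ht, norm_neg, norm_div, norm_mul, norm_mul, norm_pow, Complex.norm_real,
      Real.norm_of_nonneg hq0.le, Complex.norm_ofNat, mul_div_right_comm]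
    gcongr

theorem exists_hqfun_eq_add {q a : ℝ} (hq0 : 0 < q) (hqa : q < a) (ha1 : a < 1) :
    ∃ H : ℂ → ℂ, DifferentiableOn ℂ H (symmAnnulus a) ∧
      ∀ z ∈ symmAnnulus a, hqfun q z = H z + 2 * z / (z ^ 2 - 1) := by
  have ha0 : 0 < a := hq0.trans hqa
  have hq1 : q < 1 := hqa.trans ha1
  have hpos : 0 < a ^ 2 - q ^ 2 := by nlinarith
  set t : ℤ → ℂ → ℂ := fun k z =>
    if k = 0 then 0 else 2 * z * (q : ℂ) ^ k / (z ^ 2 - (q : ℂ) ^ (2 * k)) with ht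
  have hu : Summable fun k : ℤ => 2 * a⁻¹ / (a ^ 2 - q ^ 2) * q ^ k.natAbs :=
    (summable_pow_natAbs hq0 hq1).mul_left _
  have hle : ∀ (k : ℤ) (z : ℂ), z ∈ symmAnnulus a →
      ‖t k z‖ ≤ 2 * a⁻¹ / (a ^ 2 - q ^ 2) * q ^ k.natAbs := by
    intro k z hz
    by_cases hk : k = 0
    · simp only [ht, hk, if_true, norm_zero]; positivity
    · simp only [ht, hk, if_false]
      exact (exists_bound_hqfun_term hq0 hqa ha1 hk hz).2
  refine ⟨fun z => ∑' k, t k z, Complex.differentiableOn_tsum_of_summable_norm hu ?_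
    (isOpen_symmAnnulus a) hle, ?_⟩
  · intro k
    by_cases hk : k = 0
    · simp only [ht, hk, if_true]; exact differentiableOn_const _
    · simp only [ht, hk, if_false]
      exact DifferentiableOn.div (by fun_prop) (by fun_prop)
        fun z hz => (exists_bound_hqfun_term hq0 hqa ha1 hk hz).1
  · intro z hz
    have hs : Summable fun k => t k z := Summable.of_norm_bounded hu fun k => hle k z hz
    have h := hs.hasSum.add (hasSum_ite_eq (0 : ℤ) (2 * z / (z ^ 2 - 1)))
    rw [← h.tsum_eq]
    refine tsum_congr fun k => ?_
    by_cases hk : k = 0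
    · simp [ht, hk]
    · simp [ht, hk]

theorem circleIntegral_inv_mul_scale {c R : ℝ} (hc : c ≠ 0) {f : ℂ → ℂ} (hR : 0 ≤ R)
    (hf : ∀ z ∈ sphere (0 : ℂ) R, f (c * z) = f z) :
    (∮ z in C(0, c * R), z⁻¹ * f z) = ∮ z in C(0, R), z⁻¹ * f z := by
  have hc' : (c : ℂ) ≠ 0 := by exact_mod_cast hc
  refine intervalIntegral.integral_congr fun θ _ => ?_
  have h1 : circleMap 0 (c * R) θ = c * circleMap 0 R θ := by
    simp [circleMap, mul_assoc]
  simp only [deriv_circleMap, h1, hf _ (circleMap_mem_sphere 0 hR θ), smul_eq_mul]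
  rw [mul_inv]
  field_simp

theorem circleIntegral_sub_inv_eq_zero {w : ℂ} {r : ℝ} (hr : 0 ≤ r) (hw : r < ‖w‖) :
    (∮ z in C(0, r), (z - w)⁻¹) = 0 := by
  have hne : ∀ z ∈ closedBall (0 : ℂ) r, z - w ≠ 0 := by
    intro z hz h
    rw [sub_eq_zero] at h
    subst h
    rw [mem_closedBall_zero_iff] at hz
    linarith
  refine Complex.circleIntegral_eq_zero_of_differentiable_on_off_countable hr countable_empty
    (ContinuousOn.inv₀ (by fun_prop) hne) fun z hz => ?_
  exact DifferentiableAt.inv (by fun_prop) (hne z (ball_subset_closedBall hz.1))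

/-- The residue theorem on an annulus with simple poles at `±1`. -/
theorem circleIntegral_sphere_eq {R : ℝ} {ρ σ : ℂ} {f G : ℂ → ℂ} (hR : 0 < R) (hR1 : R ≠ 1)
    (hG : ContinuousOn G (sphere 0 R))
    (hf : ∀ z ∈ sphere (0 : ℂ) R, f z = G z + ρ / (z - 1) + σ / (z + 1)) :
    (∮ z in C(0, R), z⁻¹ * f z) = (∮ z in C(0, R), z⁻¹ * G z) +
      (ρ * (∮ z in C(0, R), (z - 1)⁻¹) - σ * (∮ z in C(0, R), (z - (-1))⁻¹) +
        (σ - ρ) * (∮ z in C(0, R), (z - 0)⁻¹)) := by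
  have hne : ∀ w : ℂ, ‖w‖ ≠ R → ∀ z ∈ sphere (0 : ℂ) R, z - w ≠ 0 := by
    intro w hw z hz h
    rw [sub_eq_zero] at h
    subst h
    exact hw (mem_sphere_zero_iff_norm.1 hz)
  have h0 := hne 0 (by simpa using hR.ne)
  have h1 := hne 1 (by simpa using hR1.symm)
  have h2 := hne (-1) (by simpa using hR1.symm)
  have hci : ∀ w : ℂ, (∀ z ∈ sphere (0 : ℂ) R, z - w ≠ 0) → ∀ b : ℂ,
      CircleIntegrable (fun z => b * (z - w)⁻¹) 0 R := fun w hw b =>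
    (continuousOn_const.mul (ContinuousOn.inv₀ (by fun_prop) hw)).circleIntegrable hR.le
  have hGi : CircleIntegrable (fun z => z⁻¹ * G z) 0 R :=
    ((ContinuousOn.inv₀ continuousOn_id (by simpa using h0)).mul hG).circleIntegrable hR.le
  have hi : CircleIntegrable (fun z => ρ * (z - 1)⁻¹ - σ * (z - (-1))⁻¹) 0 R :=
    (hci 1 h1 ρ).sub (hci (-1) h2 σ)
  have hi' : CircleIntegrable
      (fun z => ρ * (z - 1)⁻¹ - σ * (z - (-1))⁻¹ + (σ - ρ) * (z - 0)⁻¹) 0 R :=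
    hi.add (hci 0 h0 (σ - ρ))
  rw [← circleIntegral.integral_const_mul, ← circleIntegral.integral_const_mul,
    ← circleIntegral.integral_const_mul, ← circleIntegral.integral_sub (hci _ h1 _) (hci _ h2 _),
    ← circleIntegral.integral_add hi (hci _ h0 _), ← circleIntegral.integral_add hGi hi']
  refine circleIntegral.integral_congr hR.le fun z hz => ?_
  have e0 : z ≠ 0 := by simpa using h0 z hz
  have e1 := h1 z hz
  have e2 : z + 1 ≠ 0 := by simpa using h2 z hz
  simp only [hf z hz, sub_zero, sub_neg_eq_add]
  field_simp
  ring

theorem residues_eq {a q R : ℝ} {ρ σ : ℂ} {f G : ℂ → ℂ} (hq0 : 0 < q) (hR : 1 < R)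
    (hqR : q * R < 1) (hRa : R < a⁻¹) (haR : a < q * R)
    (hG : DifferentiableOn ℂ G (symmAnnulus a))
    (hf : ∀ z ∈ symmAnnulus a, ‖z‖ ≠ 1 → f z = G z + ρ / (z - 1) + σ / (z + 1))
    (hper : ∀ z ∈ sphere (0 : ℂ) R, f (q * z) = f z) : ρ = σ := by
  have hR0 : 0 < R := one_pos.trans hR
  have hr0 : 0 < q * R := mul_pos hq0 hR0
  have hsub : closedBall (0 : ℂ) R \ ball 0 (q * R) ⊆ symmAnnulus a := by
    rintro z ⟨h1, h2⟩
    rw [mem_closedBall_zero_iff] at h1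
    rw [mem_ball_zero_iff, not_lt] at h2
    exact ⟨haR.trans_le h2, h1.trans_lt hRa⟩
  have hsph : ∀ {s : ℝ}, q * R ≤ s → s ≤ R → sphere (0 : ℂ) s ⊆ symmAnnulus a := by
    intro s h1 h2 z hz
    rw [mem_sphere_zero_iff_norm] at hz
    exact hsub ⟨by rw [mem_closedBall_zero_iff]; linarith,
      by rw [mem_ball_zero_iff]; linarith⟩
  have hsR := hsph (s := R) (by linarith) le_rfl
  have hsr := hsph (s := q * R) le_rfl (by linarith)
  have hann := Complex.circleIntegral_sub_center_inv_smul_eq_of_differentiable_on_annulus_off_countable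
    (c := 0) (f := G) hr0 (show q * R ≤ R by linarith) countable_empty (hG.continuousOn.mono hsub)
    (fun z hz => hG.differentiableAt ((isOpen_symmAnnulus a).mem_nhds
      (hsub ⟨ball_subset_closedBall hz.1.1, fun h => hz.1.2 (ball_subset_closedBall h)⟩)))
  simp only [sub_zero, smul_eq_mul] at hann
  have e1 := circleIntegral_sphere_eq hR0 hR.ne' (hG.continuousOn.mono hsR)
    (fun z hz => hf z (hsR hz) (by rw [mem_sphere_zero_iff_norm.1 hz]; exact hR.ne'))
  have e2 := circleIntegral_sphere_eq hr0 hqR.ne (hG.continuousOn.mono hsr)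
    (fun z hz => hf z (hsr hz) (by rw [mem_sphere_zero_iff_norm.1 hz]; exact hqR.ne))
  rw [circleIntegral_inv_mul_scale hq0.ne' hR0.le hper, e1, hann,
    circleIntegral.integral_sub_inv_of_mem_ball (w := 1) (by simpa using hR),
    circleIntegral.integral_sub_inv_of_mem_ball (w := -1) (by simpa using hR),
    circleIntegral.integral_sub_inv_of_mem_ball (w := 0) (by simpa using hR0),
    circleIntegral.integral_sub_inv_of_mem_ball (w := 0) (by simpa using hr0),
    circleIntegral_sub_inv_eq_zero hr0.le (by simpa using hqR),
    circleIntegral_sub_inv_eq_zero hr0.le (by simpa using hqR)] at e2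
  have h3 := mul_right_cancel₀ Complex.two_pi_I_ne_zero
    (show (ρ - σ) * (2 * Real.pi * I) = 0 * (2 * Real.pi * I) by linear_combination e2)
  exact sub_eq_zero.1 h3

/-- A holomorphic function on an annulus which is invariant under scaling by `q`, where the annulus
is wide enough to contain a fundamental annulus in its interior, is constant. -/
theorem exists_eq_const_of_scale_invariant {a q R : ℝ} {F : ℂ → ℂ} (ha : 0 < a) (hq0 : 0 < q)
    (hR : 1 < R) (hqR : q * R < 1) (hRa : R < a⁻¹) (haR : a < q * R)
    (hqa : q < a)
    (hF : DifferentiableOn ℂ F (symmAnnulus a))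
    (hper : ∀ z, 1 < ‖z‖ → ‖z‖ < a⁻¹ → a < ‖(q : ℂ) * z‖ → ‖(q : ℂ) * z‖ < 1 →
      F (q * z) = F z) : ∃ c, ∀ z ∈ symmAnnulus a, F z = c := by
  have hq' : (q : ℂ) ≠ 0 := by exact_mod_cast hq0.ne'
  have hnq : ∀ z : ℂ, ‖(q : ℂ) * z‖ = q * ‖z‖ := by
    intro z; rw [norm_mul, Complex.norm_real, Real.norm_of_nonneg hq0.le]
  have ha1 : a < 1 := haR.trans hqR
  set K : Set ℂ := closedBall 0 R \ ball 0 (q * R) with hK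
  have hKmem : ∀ z, z ∈ K ↔ ‖z‖ ≤ R ∧ q * R ≤ ‖z‖ := by
    intro z; simp [hK]
  have hKc : IsCompact K := (isCompact_closedBall _ _).diff isOpen_ball
  have hKS : K ⊆ symmAnnulus a := fun z hz =>
    ⟨haR.trans_le ((hKmem z).1 hz).2, ((hKmem z).1 hz).1.trans_lt hRa⟩
  have hKn : K.Nonempty := ⟨1, (hKmem 1).2 (by simp; constructor <;> linarith)⟩
  obtain ⟨c, hcK, hc⟩ := hKc.exists_isMaxOn hKn (hF.continuousOn.mono hKS).norm
  refine ⟨F c, fun z hz => Complex.eqOn_of_isPreconnected_of_isMaxOn_norm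
    (isPreconnected_symmAnnulus ha) (isOpen_symmAnnulus a) hF (hKS hcK) ?_ hz⟩
  intro w hw
  suffices h : ∃ v ∈ K, F v = F w by
    obtain ⟨v, hv, hvw⟩ := h
    have := hc hv
    simpa [← hvw] using this
  obtain ⟨h1, h2⟩ := hw
  rcases lt_or_ge R ‖w‖ with h | h
  · have h3 : q * R < q * ‖w‖ := by gcongr
    have h4 : q * ‖w‖ < q * a⁻¹ := by gcongr
    have h5 : q * a⁻¹ < 1 := by rwa [← div_eq_mul_inv, div_lt_one ha]
    refine ⟨q * w, (hKmem _).2 ?_, hper w (hR.trans h) h2 ?_ ?_⟩ <;> rw [hnq]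
    · exact ⟨by linarith, h3.le⟩
    · linarith
    · linarith
  · rcases lt_or_ge ‖w‖ (q * R) with h' | h'
    · obtain ⟨v, rfl⟩ : ∃ v : ℂ, w = q * v := ⟨(q : ℂ)⁻¹ * w, (mul_inv_cancel_left₀ hq' w).symm⟩
      rw [hnq] at h'
      have h3 : ‖v‖ < R := lt_of_mul_lt_mul_left h' hq0.le
      have h4 : q * 1 < q * ‖v‖ := by rw [← hnq v]; linarith
      have h5 : 1 < ‖v‖ := lt_of_mul_lt_mul_left h4 hq0.le
      refine ⟨v, (hKmem _).2 ⟨h3.le, by linarith⟩, (hper v h5 (h3.trans hRa) h1 ?_).symm⟩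
      rw [hnq]; linarith
    · exact ⟨w, (hKmem w).2 ⟨h, h'⟩, rfl⟩

/-- The domain `ℂ ∖ ({0} ∪ {±q^k : k ∈ ℤ})`. -/
def hqDomain (q : ℝ) : Set ℂ :=
  {z : ℂ | z ≠ 0 ∧ ∀ k : ℤ, z ≠ (q : ℂ) ^ k ∧ z ≠ -((q : ℂ) ^ k)}

theorem mul_mem_hqDomain_iff {q : ℝ} (hq : q ≠ 0) {z : ℂ} :
    (q : ℂ) * z ∈ hqDomain q ↔ z ∈ hqDomain q := by
  have hq' : (q : ℂ) ≠ 0 := by exact_mod_cast hq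
  have h : ∀ k : ℤ, (q : ℂ) ^ (k + 1) = q * q ^ k := fun k => by rw [zpow_add_one₀ hq', mul_comm]
  simp only [hqDomain, mem_ofPred_eq, mul_ne_zero_iff, hq', ne_eq, not_false_eq_true, true_and]
  refine and_congr_right fun _ => ⟨fun hz k => ?_, fun hz k => ?_⟩
  · have := hz (k + 1)
    rw [h, ← mul_neg, mul_right_inj' hq', mul_right_inj' hq'] at this
    exact this
  · have := hz (k - 1)
    rw [← sub_add_cancel k 1, h, ← mul_neg, mul_right_inj' hq', mul_right_inj' hq']
    exact this

theorem zpow_mul_mem_hqDomain {q : ℝ} (hq : q ≠ 0) {z : ℂ} (hz : z ∈ hqDomain q) (n : ℤ) :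
    (q : ℂ) ^ n * z ∈ hqDomain q := by
  have hq' : (q : ℂ) ≠ 0 := by exact_mod_cast hq
  have h : ∀ k : ℤ, (q : ℂ) ^ (k + 1) * z = q * (q ^ k * z) := fun k => by
    rw [zpow_add_one₀ hq']; ring
  induction n with
  | zero => simpa using hz
  | succ k ih => rw [h]; exact (mul_mem_hqDomain_iff hq).2 ih
  | pred k ih =>
    rw [← sub_add_cancel (-(k : ℤ)) 1, h] at ih
    exact (mul_mem_hqDomain_iff hq).1 ih

theorem apply_zpow_mul_eq {q : ℝ} (hq : q ≠ 0) {f : ℂ → ℂ}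
    (hf : ∀ z ∈ hqDomain q, f (q * z) = f z) {z : ℂ} (hz : z ∈ hqDomain q) (n : ℤ) :
    f ((q : ℂ) ^ n * z) = f z := by
  have hq' : (q : ℂ) ≠ 0 := by exact_mod_cast hq
  have h : ∀ k : ℤ, f ((q : ℂ) ^ (k + 1) * z) = f (q ^ k * z) := fun k => by
    rw [← hf _ (zpow_mul_mem_hqDomain hq hz k), zpow_add_one₀ hq']; ring_nf
  induction n with
  | zero => simp
  | succ k ih => rw [h, ih]
  | pred k ih => rw [← ih, ← h, sub_add_cancel]

theorem mem_hqDomain_of_mem_symmAnnulus {q a : ℝ} (hq0 : 0 < q) (hqa : q < a) (ha1 : a < 1)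
    {z : ℂ} (hz : z ∈ symmAnnulus a) (h1 : z ≠ 1) (h2 : z ≠ -1) : z ∈ hqDomain q := by
  have ha0 : 0 < a := hq0.trans hqa
  have hq1 : q < 1 := hqa.trans ha1
  have key : ∀ k : ℤ, ‖z‖ = q ^ k → k = 0 := by
    intro k hk
    obtain ⟨h3, h4⟩ := hz
    rw [hk] at h3 h4
    have h5 : q ^ k < q ^ (-1 : ℤ) := by
      rw [zpow_neg_one]; exact h4.trans (inv_strictAnti₀ hq0 hqa)
    have h6 : q ^ (1 : ℤ) < q ^ k := by rw [zpow_one]; exact hqa.trans h3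
    rw [zpow_lt_zpow_iff_right_of_lt_one₀ hq0 hq1] at h5 h6
    omega
  have hn : ∀ k : ℤ, ‖(q : ℂ) ^ k‖ = q ^ k := fun k => by
    rw [norm_zpow, Complex.norm_real, Real.norm_of_nonneg hq0.le]
  refine ⟨norm_pos_iff.1 (ha0.trans hz.1), fun k => ⟨fun h => ?_, fun h => ?_⟩⟩
  · have := key k (by rw [h, hn])
    subst this
    exact h1 (by simpa using h)
  · have := key k (by rw [h, norm_neg, hn])
    subst this
    exact h2 (by simpa using h)

theorem statement9 (q : ℝ) (hq0 : 0 < q) (hq1 : q < 1) (C : ℂ → ℂ)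
    -- C is analytic on ℂ ∖ ({0} ∪ {±q^k : k ∈ ℤ})
    (hC : DifferentiableOn ℂ C
      {z : ℂ | z ≠ 0 ∧ ∀ k : ℤ, z ≠ (q : ℂ) ^ k ∧ z ≠ -((q : ℂ) ^ k)})
    -- C has at most simple poles at the points ±q^k, k ∈ ℤ
    (hpole : ∀ (k : ℤ) (ε : ℂ), ε = 1 ∨ ε = -1 →
      ∃ g : ℂ → ℂ, AnalyticAt ℂ g (ε * (q : ℂ) ^ k) ∧
        ∀ᶠ z in 𝓝[≠] (ε * (q : ℂ) ^ k), C z = g z / (z - ε * (q : ℂ) ^ k))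
    -- C(qz) = C(z) on its domain
    (hperiod : ∀ z : ℂ, z ≠ 0 → (∀ k : ℤ, z ≠ (q : ℂ) ^ k ∧ z ≠ -((q : ℂ) ^ k)) →
      C ((q : ℂ) * z) = C z) :
    ∃ c₀ c₁ : ℂ, ∀ z : ℂ, z ≠ 0 → (∀ k : ℤ, z ≠ (q : ℂ) ^ k ∧ z ≠ -((q : ℂ) ^ k)) →
      C z = c₁ * hqfun q z + c₀ := by
  obtain ⟨p, hp0, hp1, hpq⟩ : ∃ p : ℝ, 0 < p ∧ p < 1 ∧ p ^ 4 = q := by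
    refine ⟨q ^ (1 / 4 : ℝ), by positivity, Real.rpow_lt_one hq0.le hq1 (by norm_num), ?_⟩
    rw [← Real.rpow_natCast, ← Real.rpow_mul hq0.le]
    norm_num
  set a : ℝ := p ^ 3 with ha
  set R : ℝ := (p ^ 2)⁻¹ with hR
  have ha0 : 0 < a := by positivity
  have ha1 : a < 1 := pow_lt_one₀ hp0.le hp1 (by norm_num)
  have hqa : q < a := by rw [← hpq]; exact pow_lt_pow_right_of_lt_one₀ hp0 hp1 (by norm_num)
  have hR1 : 1 < R := (one_lt_inv₀ (by positivity)).2 (pow_lt_one₀ hp0.le hp1 (by norm_num))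
  have hqRp : q * R = p ^ 2 := by rw [← hpq, hR]; field_simp
  have hqR : q * R < 1 := by rw [hqRp]; exact pow_lt_one₀ hp0.le hp1 (by norm_num)
  have haR : a < q * R := by
    rw [hqRp]; exact pow_lt_pow_right_of_lt_one₀ hp0 hp1 (by norm_num)
  have hRa : R < a⁻¹ := inv_strictAnti₀ ha0 (by rw [← hqRp]; exact haR)
  have hnq : ∀ z : ℂ, ‖(q : ℂ) * z‖ = q * ‖z‖ := by
    intro z; rw [norm_mul, Complex.norm_real, Real.norm_of_nonneg hq0.le]
  have hdom := fun z => mem_hqDomain_of_mem_symmAnnulus (z := z) hq0 hqa ha1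
  have hdom' : ∀ z ∈ symmAnnulus a, ‖z‖ ≠ 1 → z ∈ hqDomain q := fun z hz h =>
    hdom z hz (by rintro rfl; simp at h) (by rintro rfl; simp at h)
  have hper : ∀ z ∈ hqDomain q, C (q * z) = C z := fun z hz => hperiod z hz.1 hz.2
  have hmem : ∀ w : ℂ, ‖w‖ = 1 → w ∈ symmAnnulus a := fun w hw =>
    ⟨by rwa [hw], by rw [hw]; exact (one_lt_inv₀ ha0).2 ha1⟩
  obtain ⟨g₁, hg₁, hC₁⟩ := hpole 0 1 (Or.inl rfl)
  obtain ⟨g₂, hg₂, hC₂⟩ := hpole 0 (-1) (Or.inr rfl)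
  simp only [zpow_zero, mul_one] at hg₁ hC₁ hg₂ hC₂
  obtain ⟨F, hF, hFC⟩ := exists_differentiableOn_sub_principalPart (S := symmAnnulus a \ {-1})
    (c := 1) ((isOpen_symmAnnulus a).sdiff isClosed_singleton)
    ⟨hmem 1 (by simp), by norm_num [eq_neg_iff_add_eq_zero]⟩
    (hC.mono fun z hz => hdom z hz.1.1 hz.2 hz.1.2) hg₁ hC₁
  have hg₃ : AnalyticAt ℂ (fun z => g₂ z - (z - (-1)) * (g₁ 1 / (z - 1))) (-1) :=
    hg₂.sub (AnalyticAt.mul (by fun_prop) (analyticAt_const.div (by fun_prop) (by norm_num)))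
  have hF₃ : ∀ᶠ z in 𝓝[≠] (-1 : ℂ),
      F z = (g₂ z - (z - (-1)) * (g₁ 1 / (z - 1))) / (z - (-1)) := by
    have hne : ∀ᶠ z in 𝓝[≠] (-1 : ℂ), z ≠ 1 :=
      eventually_nhdsWithin_of_eventually_nhds (isOpen_ne.mem_nhds (by norm_num))
    filter_upwards [hC₂, hne, self_mem_nhdsWithin] with z h1 h2 h3
    rw [hFC z h2, h1, sub_div, mul_div_cancel_left₀ _ (sub_ne_zero.2 h3)]
  obtain ⟨G, hG, hGF⟩ := exists_differentiableOn_sub_principalPart (isOpen_symmAnnulus a)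
    (hmem (-1) (by simp)) hF hg₃ hF₃
  simp only [sub_self, zero_mul, sub_zero, sub_neg_eq_add] at hGF
  have hCG : ∀ z, z ≠ 1 → z ≠ -1 → C z = G z + g₁ 1 / (z - 1) + g₂ (-1) / (z + 1) := by
    intro z h1 h2
    rw [hGF z h2, hFC z h1]; ring
  have hres : g₁ 1 = g₂ (-1) := by
    refine residues_eq (f := C) hq0 hR1 hqR hRa haR hG
      (fun z _ h => hCG z (by rintro rfl; simp at h) (by rintro rfl; simp at h)) fun z hz => ?_
    rw [mem_sphere_zero_iff_norm] at hz
    exact hper z (hdom' z ⟨by linarith, by rwa [hz]⟩ (by rw [hz]; exact hR1.ne'))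
  obtain ⟨H, hH, hHq⟩ := exists_hqfun_eq_add hq0 hqa ha1
  have hCH : ∀ z ∈ symmAnnulus a, z ≠ 1 → z ≠ -1 →
      C z = g₁ 1 * hqfun q z + (G z - g₁ 1 * H z) := by
    intro z hz h1 h2
    have e1 : z - 1 ≠ 0 := sub_ne_zero.2 h1
    have e2 : z + 1 ≠ 0 := by rwa [ne_eq, add_eq_zero_iff_eq_neg]
    rw [hCG z h1 h2, hHq z hz, ← hres, show z ^ 2 - 1 = (z - 1) * (z + 1) by ring]
    field_simp
    ring
  obtain ⟨c, hc⟩ := exists_eq_const_of_scale_invariant (F := fun z => G z - g₁ 1 * H z) ha0 hq0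
    hR1 hqR hRa haR hqa (hG.sub (hH.const_mul _)) (by
      intro z h1 h2 h3 h4
      have hz : z ∈ symmAnnulus a := ⟨by linarith, h2⟩
      have hqz : (q : ℂ) * z ∈ symmAnnulus a := ⟨h3, by linarith⟩
      have n1 := hCH z hz (by rintro rfl; simp at h1) (by rintro rfl; simp at h1)
      have n2 := hCH _ hqz (by intro h; simp [h] at h4) (by intro h; simp [h] at h4)
      rw [hqfun_mul hq0.ne', hper z (hdom' z hz h1.ne'), n1] at n2
      exact (add_left_cancel n2).symm)
  refine ⟨c, g₁ 1, fun z hz0 hz => ?_⟩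
  have hzd : z ∈ hqDomain q := ⟨hz0, hz⟩
  obtain ⟨n, hn1, hn2⟩ := exists_mem_Ico_zpow (div_pos (norm_pos_iff.2 hz0) (mul_pos hq0
    (one_pos.trans hR1))) ((one_lt_inv₀ hq0).2 hq1)
  have hqn : 0 < q ^ n := zpow_pos hq0 n
  have hnz : ‖(q : ℂ) ^ n * z‖ = q ^ n * ‖z‖ := by
    rw [norm_mul, norm_zpow, Complex.norm_real, Real.norm_of_nonneg hq0.le]
  rw [inv_zpow, le_div_iff₀ (by positivity), inv_mul_le_iff₀ hqn] at hn1
  rw [inv_zpow, div_lt_iff₀ (by positivity), zpow_add_one₀ hq0.ne',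
    show (q ^ n * q)⁻¹ * (q * R) = (q ^ n)⁻¹ * R by field_simp, lt_inv_mul_iff₀ hqn] at hn2
  have hw : (q : ℂ) ^ n * z ∈ symmAnnulus a :=
    ⟨by rw [hnz]; linarith, by rw [hnz]; linarith⟩
  have hwd := zpow_mul_mem_hqDomain hq0.ne' hzd n
  have hfin := hCH _ hw (by simpa using (hwd.2 0).1) (by simpa using (hwd.2 0).2)
  rw [hc _ hw, apply_zpow_mul_eq hq0.ne' hper hzd,
    apply_zpow_mul_eq hq0.ne' (fun z _ => hqfun_mul hq0.ne' z) hzd] at hfin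
  exact hfin
end

section
/- The function h_q has vanishing real part on the circles |z| = 1 and |z| = q^{1/2}: for every θ ∈ ℝ with e^{iθ} ∉ {1, −1}, Re h_q(e^{iθ}) = 0, and for every θ ∈ ℝ, Re h_q(q^{1/2} e^{iθ}) = 0. -/
open Complex Topology

/-- The reflection `z ↦ q ^ m / z` sends the `k`-th term of the series defining `hqfun`
to minus the `(m - k)`-th term. -/
lemma hqfun_term_reflect {q : ℂ} (hq : q ≠ 0) {z w : ℂ} {m : ℤ} (hzw : w * z = q ^ m) (k : ℤ) :
    2 * w * q ^ k / (w ^ 2 - q ^ (2 * k)) =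
      -(2 * z * q ^ (m - k) / (z ^ 2 - q ^ (2 * (m - k)))) := by
  have hz : z ≠ 0 := right_ne_zero_of_mul (hzw ▸ zpow_ne_zero m hq)
  have hb : q ^ k ≠ 0 := zpow_ne_zero k hq
  have hsq (n : ℤ) : q ^ (2 * n) = (q ^ n) ^ 2 := by rw [mul_comm, zpow_mul]; norm_cast
  rw [hsq, hsq, zpow_sub₀ hq, ← hzw]
  generalize q ^ k = b at hb
  have hden : z ^ 2 - (w * z / b) ^ 2 = -((z / b) ^ 2 * (w ^ 2 - b ^ 2)) := by
    field_simp
    ring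
  rw [hden, div_neg, neg_neg]
  by_cases h : w ^ 2 - b ^ 2 = 0
  · simp [h]
  · field_simp

/-- The real part of `hqfun q` vanishes on the circle `|z| ^ 2 = q ^ m`. -/
lemma hqfun_re_eq_zero {q : ℝ} (hq : q ≠ 0) {z : ℂ} {m : ℤ}
    (hz : (starRingEnd ℂ) z * z = (q : ℂ) ^ m) : (hqfun q z).re = 0 := by
  have hconj : (starRingEnd ℂ) (hqfun q z) = -hqfun q z := by
    calc (starRingEnd ℂ) (hqfun q z)
        = ∑' k : ℤ, -(2 * z * (q : ℂ) ^ (m - k) / (z ^ 2 - (q : ℂ) ^ (2 * (m - k)))) := by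
          rw [hqfun, Complex.conj_tsum]
          refine tsum_congr fun k => ?_
          rw [← hqfun_term_reflect (Complex.ofReal_ne_zero.2 hq) hz]
          simp [map_ofNat]
      _ = -hqfun q z := by
          rw [tsum_neg, hqfun, ← (Equiv.subLeft m).tsum_eq]
          simp only [Equiv.subLeft_apply, sub_sub_cancel]
  have hre := congrArg Complex.re hconj
  rw [Complex.conj_re, Complex.neg_re] at hre
  linarith

theorem statement10 (q : ℝ) (hq0 : 0 < q) (hq1 : q < 1) :
    (∀ θ : ℝ, Complex.exp (θ * Complex.I) ≠ 1 → Complex.exp (θ * Complex.I) ≠ -1 →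
      (hqfun q (Complex.exp (θ * Complex.I))).re = 0) ∧
    (∀ θ : ℝ, (hqfun q ((Real.sqrt q : ℝ) * Complex.exp (θ * Complex.I))).re = 0) := by
  refine ⟨fun θ _ _ => hqfun_re_eq_zero (m := 0) hq0.ne' ?_,
    fun θ => hqfun_re_eq_zero (m := 1) hq0.ne' ?_⟩
  · simp [Complex.conj_mul', Complex.norm_exp_ofReal_mul_I]
  · rw [Complex.conj_mul', norm_mul, Complex.norm_exp_ofReal_mul_I, mul_one, Complex.norm_real,
      Real.norm_of_nonneg (Real.sqrt_nonneg q), zpow_one, ← Complex.ofReal_pow,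
      Real.sq_sqrt hq0.le]
end

section
/- Along the ray z = r e^{iπ/4}, r > 0, the real part of h_q vanishes exactly on the square-root lattice: for every real r > 0, Re h_q(r e^{iπ/4}) = 0 if and only if r = q^{k/2} for some k ∈ ℤ (so at these points h_q(r e^{iπ/4}) is purely imaginary, and at all other r > 0 its real part is nonzero). -/
open Complex Topology

/-- The periodised hyperbolic cosecant `∑_{k ∈ ℤ} 1 / sinh (w + k L)`. -/
noncomputable def cschSum (L : ℝ) (w : ℂ) : ℂ :=
  ∑' k : ℤ, (Complex.sinh (w + k * L))⁻¹

/-- The periodised hyperbolic cosecant with the term of index `0` removed. -/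
noncomputable def cschSumReg (L : ℝ) (w : ℂ) : ℂ :=
  ∑' k : ℤ, if k = 0 then 0 else (Complex.sinh (w + k * L))⁻¹

lemma sinh_abs_re_le_norm_sinh (w : ℂ) : Real.sinh |w.re| ≤ ‖Complex.sinh w‖ := by
  have h := abs_norm_sub_norm_le (Complex.exp w) (Complex.exp (-w))
  rw [Complex.norm_exp, Complex.norm_exp, Complex.neg_re] at h
  rw [← Real.abs_sinh, Complex.sinh, Real.sinh_eq, norm_div, abs_div]
  simpa using div_le_div_of_nonneg_right h (by norm_num : (0 : ℝ) ≤ 2)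

lemma sq_div_four_le_sinh {t : ℝ} (ht : 0 ≤ t) : t ^ 2 / 4 ≤ Real.sinh t := by
  have h1 := Real.quadratic_le_exp_of_nonneg ht
  have h2 : Real.exp (-t) ≤ 1 := Real.exp_le_one_iff.2 (by linarith)
  rw [Real.sinh_eq]
  linarith

lemma norm_inv_sinh_add_le {L : ℝ} (hL : 0 < L) {w : ℂ} (hw : |w.re| < 3 * L / 4) {k : ℤ}
    (hk : k ≠ 0) :
    ‖(Complex.sinh (w + k * L))⁻¹‖ ≤ 64 / L ^ 2 * (1 / (k : ℝ) ^ 2) := by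
  have hk1 : (1 : ℝ) ≤ |(k : ℝ)| := by exact_mod_cast Int.one_le_abs hk
  have hre : (w + k * L : ℂ).re = w.re + k * L := by simp
  have h1 : |(k : ℝ)| * L / 4 ≤ |(w + k * L : ℂ).re| := by
    rw [hre]
    have h2 : |(k : ℝ) * L| - |w.re| ≤ |w.re + k * L| := by
      have := abs_sub_abs_le_abs_sub ((k : ℝ) * L) (-w.re)
      rwa [abs_neg, sub_neg_eq_add, add_comm ((k : ℝ) * L) w.re] at this
    rw [abs_mul, abs_of_pos hL] at h2
    nlinarith
  have h3 : (k : ℝ) ^ 2 * L ^ 2 / 64 ≤ ‖Complex.sinh (w + k * L)‖ := by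
    refine le_trans ?_ (sinh_abs_re_le_norm_sinh _)
    refine le_trans ?_ (Real.sinh_le_sinh.2 h1)
    refine le_trans (le_of_eq ?_) (sq_div_four_le_sinh (by positivity))
    rw [div_pow, mul_pow, sq_abs]
    ring
  have hk0 : (k : ℝ) ≠ 0 := by exact_mod_cast hk
  rw [norm_inv]
  refine (inv_anti₀ (by positivity) h3).trans (le_of_eq ?_)
  field_simp

lemma summable_cschSum_bound (L : ℝ) :
    Summable fun k : ℤ => 64 / L ^ 2 * (1 / (k : ℝ) ^ 2) :=
  (Real.summable_one_div_int_pow.2 one_lt_two).mul_left _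

lemma summable_cschSum {L : ℝ} (hL : 0 < L) {w : ℂ} (hw : |w.re| < 3 * L / 4) :
    Summable fun k : ℤ => (Complex.sinh (w + k * L))⁻¹ := by
  refine Summable.of_norm_bounded_eventually (summable_cschSum_bound L) ?_
  filter_upwards [(Set.finite_singleton (0 : ℤ)).compl_mem_cofinite] with k hk
  exact norm_inv_sinh_add_le hL hw hk

lemma cschSum_eq_add {L : ℝ} (hL : 0 < L) {w : ℂ} (hw : |w.re| < 3 * L / 4) :
    cschSum L w = (Complex.sinh w)⁻¹ + cschSumReg L w := by
  rw [cschSum, (summable_cschSum hL hw).tsum_eq_add_tsum_ite 0, cschSumReg]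
  simp

lemma sinh_ne_zero_of_re_ne_zero {w : ℂ} (hw : w.re ≠ 0) : Complex.sinh w ≠ 0 := by
  rw [← norm_pos_iff]
  exact (Real.sinh_pos_iff.2 (abs_pos.2 hw)).trans_le (sinh_abs_re_le_norm_sinh w)

lemma isOpen_abs_re_lt (c : ℝ) : IsOpen {w : ℂ | |w.re| < c} :=
  isOpen_lt (Complex.continuous_re.abs) continuous_const

lemma differentiableOn_cschSumReg {L : ℝ} (hL : 0 < L) :
    DifferentiableOn ℂ (cschSumReg L) {w | |w.re| < 3 * L / 4} := by
  refine Complex.differentiableOn_tsum_of_summable_norm (summable_cschSum_bound L) ?_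
    (isOpen_abs_re_lt _) ?_
  · intro k w hw
    by_cases hk : k = 0
    · simp only [hk, if_true]
      exact differentiableWithinAt_const 0
    · simp only [hk, if_false]
      have hne : Complex.sinh (w + k * L) ≠ 0 := by
        apply sinh_ne_zero_of_re_ne_zero
        intro h0
        have hre : w.re + k * L = 0 := by simpa using h0
        have hk1 : (1 : ℝ) ≤ |(k : ℝ)| := by exact_mod_cast Int.one_le_abs hk
        have h2 : |w.re| = |(k : ℝ)| * L := by
          rw [eq_neg_of_add_eq_zero_left hre, abs_neg, abs_mul, abs_of_pos hL]
        have hw' : |w.re| < 3 * L / 4 := hw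
        nlinarith
      have hd : DifferentiableAt ℂ (fun w : ℂ => Complex.sinh (w + k * L)) w := by fun_prop
      exact (hd.inv hne).differentiableWithinAt
  · intro k w hw
    by_cases hk : k = 0
    · simp [hk]
    · simpa only [hk, if_false] using norm_inv_sinh_add_le hL hw hk

lemma cschSum_neg (L : ℝ) (w : ℂ) : cschSum L (-w) = -cschSum L w := by
  rw [cschSum, cschSum, ← tsum_neg, ← (Equiv.neg ℤ).tsum_eq]
  refine tsum_congr fun k => ?_
  rw [← inv_neg, ← Complex.sinh_neg]
  congr 2
  simp only [Equiv.neg_apply]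
  push_cast
  ring

lemma cschSumReg_neg (L : ℝ) (w : ℂ) : cschSumReg L (-w) = -cschSumReg L w := by
  rw [cschSumReg, cschSumReg, ← tsum_neg, ← (Equiv.neg ℤ).tsum_eq]
  refine tsum_congr fun k => ?_
  by_cases hk : k = 0
  · simp [hk]
  · simp only [Equiv.neg_apply, neg_eq_zero, hk, if_false]
    rw [← inv_neg, ← Complex.sinh_neg]
    congr 2
    push_cast
    ring

lemma cschSum_conj (L : ℝ) (w : ℂ) :
    cschSum L ((starRingEnd ℂ) w) = (starRingEnd ℂ) (cschSum L w) := by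
  rw [cschSum, cschSum, Complex.conj_tsum]
  refine tsum_congr fun k => ?_
  rw [map_inv₀, ← Complex.sinh_conj]
  simp

lemma cschSumReg_conj (L : ℝ) (w : ℂ) :
    cschSumReg L ((starRingEnd ℂ) w) = (starRingEnd ℂ) (cschSumReg L w) := by
  rw [cschSumReg, cschSumReg, Complex.conj_tsum]
  refine tsum_congr fun k => ?_
  by_cases hk : k = 0
  · simp [hk]
  · simp only [hk, if_false]
    rw [map_inv₀, ← Complex.sinh_conj]
    simp

lemma cschSum_add_int_mul (L : ℝ) (w : ℂ) (m : ℤ) : cschSum L (w + m * L) = cschSum L w := by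
  rw [cschSum, cschSum, ← (Equiv.addLeft m).tsum_eq fun k : ℤ => (Complex.sinh (w + k * L))⁻¹]
  refine tsum_congr fun k => ?_
  congr 2
  simp only [Equiv.coe_addLeft]
  push_cast
  ring

lemma cschSum_add_pi_mul_I (L : ℝ) (w : ℂ) : cschSum L (w + Real.pi * Complex.I) = -cschSum L w := by
  rw [cschSum, cschSum, ← tsum_neg]
  refine tsum_congr fun k => ?_
  rw [← inv_neg, ← Complex.sinh_add_pi_mul_I]
  congr 2
  ring

lemma re_eq_zero_of_conj_eq_neg {x : ℂ} (h : (starRingEnd ℂ) x = -x) : x.re = 0 := by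
  have := congrArg Complex.re h
  simp only [Complex.conj_re, Complex.neg_re] at this
  linarith

lemma cschSumReg_re_of_re_eq_zero (L : ℝ) {w : ℂ} (hw : w.re = 0) : (cschSumReg L w).re = 0 := by
  apply re_eq_zero_of_conj_eq_neg
  rw [← cschSumReg_conj, ← cschSumReg_neg]
  congr 1
  apply Complex.ext <;> simp [hw]

lemma cschSum_re_of_two_mul_re {L : ℝ} {w : ℂ} {m : ℤ} (hw : 2 * w.re = m * L) :
    (cschSum L w).re = 0 := by
  apply re_eq_zero_of_conj_eq_neg
  rw [← cschSum_conj, ← cschSum_neg, ← cschSum_add_int_mul L (-w) m]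
  congr 1
  apply Complex.ext
  · simp
    linarith
  · simp

lemma cschSum_re_of_im_eq_pi_div_two (L : ℝ) {w : ℂ} (hw : w.im = Real.pi / 2) :
    (cschSum L w).re = 0 := by
  apply re_eq_zero_of_conj_eq_neg
  rw [← cschSum_conj, ← neg_eq_iff_eq_neg, ← cschSum_add_pi_mul_I]
  congr 1
  apply Complex.ext
  · simp
  · simp [hw]
    ring

lemma cschSum_ofReal_re_pos {L u : ℝ} (hu0 : 0 < u) (hu : u < L / 2) :
    0 < (cschSum L u).re := by
  have hL : 0 < L := by linarith
  have key : ∀ v : ℝ, |v| < 3 * L / 4 →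
      Summable (fun k : ℤ => (Real.sinh (v + k * L))⁻¹) ∧
        (cschSum L v).re = ∑' k : ℤ, (Real.sinh (v + k * L))⁻¹ := by
    intro v hv
    have hs := summable_cschSum hL (w := v) (by simpa using hv)
    have hfun : (fun k : ℤ => (Complex.sinh ((v : ℂ) + k * L))⁻¹) =
        fun k : ℤ => (((Real.sinh (v + k * L))⁻¹ : ℝ) : ℂ) := by
      funext k
      push_cast
      rfl
    rw [cschSum]
    rw [hfun] at hs ⊢
    exact ⟨Complex.summable_ofReal.1 hs, by rw [← Complex.ofReal_tsum, Complex.ofReal_re]⟩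
  obtain ⟨hs1, he1⟩ := key u (by rw [abs_of_pos hu0]; linarith)
  obtain ⟨hs2, he2⟩ := key (-u) (by rw [abs_neg, abs_of_pos hu0]; linarith)
  have hs3 := hs2
  rw [← (Equiv.addLeft (1 : ℤ)).summable_iff] at hs3
  rw [← (Equiv.addLeft (1 : ℤ)).tsum_eq] at he2
  have hneg : (cschSum L ((-u : ℝ) : ℂ)).re = -(cschSum L u).re := by
    rw [Complex.ofReal_neg, cschSum_neg, Complex.neg_re]
  have hpos : ∀ k : ℤ, 0 < (Real.sinh (u + k * L))⁻¹ -
      (Real.sinh (-u + ((Equiv.addLeft (1 : ℤ)) k : ℤ) * L))⁻¹ := by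
    intro k
    have hlt : Real.sinh (u + k * L) <
        Real.sinh (-u + ((Equiv.addLeft (1 : ℤ)) k : ℤ) * L) := by
      rw [Real.sinh_lt_sinh]
      simp only [Equiv.coe_addLeft]
      push_cast
      linarith
    rw [sub_pos]
    rcases le_or_gt 0 k with hk | hk
    · have hk' : (0 : ℝ) ≤ k := by exact_mod_cast hk
      exact inv_strictAnti₀ (Real.sinh_pos_iff.2 (by positivity)) hlt
    · have hk' : (k : ℝ) ≤ -1 := by exact_mod_cast Int.le_sub_one_of_lt hk
      have hneg' : Real.sinh (-u + ((Equiv.addLeft (1 : ℤ)) k : ℤ) * L) < 0 := by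
        rw [Real.sinh_neg_iff]
        simp only [Equiv.coe_addLeft]
        push_cast
        nlinarith
      exact (inv_lt_inv_of_neg hneg' (hlt.trans hneg')).2 hlt
  have htot := (hs1.sub hs3).tsum_pos (fun k => (hpos k).le) 0 (hpos 0)
  rw [hs1.tsum_sub hs3] at htot
  simp only [Function.comp_apply] at htot
  linarith

lemma inv_sinh_re_nonneg {w : ℂ} (hre : 0 ≤ w.re) (him : |w.im| ≤ Real.pi / 2) :
    0 ≤ ((Complex.sinh w)⁻¹).re := by
  rw [Complex.inv_re]
  refine div_nonneg ?_ (Complex.normSq_nonneg _)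
  have h : (Complex.sinh w).re = Real.sinh w.re * Real.cos w.im := by
    rw [Complex.sinh, Real.sinh_eq, Complex.div_ofNat_re, Complex.sub_re, Complex.exp_re,
      Complex.exp_re, Complex.neg_re, Complex.neg_im, Real.cos_neg]
    ring
  rw [h]
  rw [abs_le] at him
  exact mul_nonneg (Real.sinh_nonneg_iff.2 hre) (Real.cos_nonneg_of_mem_Icc ⟨by linarith, him.2⟩)

lemma differentiableOn_cschSum {L : ℝ} (hL : 0 < L) :
    DifferentiableOn ℂ (cschSum L) {w | 0 < w.re ∧ w.re < 3 * L / 4} := by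
  have habs : ∀ w ∈ {w : ℂ | 0 < w.re ∧ w.re < 3 * L / 4}, |w.re| < 3 * L / 4 := by
    intro w hw
    rw [abs_of_pos hw.1]
    exact hw.2
  refine DifferentiableOn.congr (f := fun w => (Complex.sinh w)⁻¹ + cschSumReg L w) ?_
    fun w hw => cschSum_eq_add hL (habs w hw)
  refine DifferentiableOn.add ?_ ((differentiableOn_cschSumReg hL).mono habs)
  exact DifferentiableOn.inv Complex.differentiable_sinh.differentiableOn
    fun w hw => sinh_ne_zero_of_re_ne_zero hw.1.ne'

lemma closure_Ioo_reProdIm_Ioo {a b c d : ℝ} (hab : a < b) (hcd : c < d) :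
    closure (Set.Ioo a b ×ℂ Set.Ioo c d) = Set.Icc a b ×ℂ Set.Icc c d := by
  rw [Complex.closure_reProdIm, closure_Ioo hab.ne, closure_Ioo hcd.ne]

lemma diffContOnCl_exp_neg_cschSum {L ε : ℝ} (hε0 : 0 < ε) (hεL : ε < L / 2) :
    DiffContOnCl ℂ (fun z => Complex.exp (-cschSum L z))
      (Set.Ioo ε (L / 2) ×ℂ Set.Ioo 0 (Real.pi / 2)) := by
  have hL : 0 < L := by linarith
  apply DifferentiableOn.diffContOnCl
  refine ((differentiableOn_cschSum hL).mono fun z hz => ?_).neg.cexp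
  rw [closure_Ioo_reProdIm_Ioo hεL Real.pi_div_two_pos] at hz
  have hz1 := (Complex.mem_reProdIm.1 hz).1
  exact ⟨hε0.trans_le hz1.1, by linarith [hz1.2]⟩

lemma cschSum_re_nonneg {L : ℝ} {w : ℂ} (hre0 : 0 < w.re) (hre1 : w.re < L / 2)
    (him0 : 0 ≤ w.im) (him1 : w.im ≤ Real.pi / 2) : 0 ≤ (cschSum L w).re := by
  have hL : 0 < L := by linarith
  refine le_of_forall_pos_sub_le fun δ hδ => ?_
  have hK : IsCompact (Set.Icc 0 (L / 2) ×ℂ Set.Icc 0 (Real.pi / 2)) :=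
    isCompact_Icc.reProdIm isCompact_Icc
  have hKc : ContinuousOn (cschSumReg L) (Set.Icc 0 (L / 2) ×ℂ Set.Icc 0 (Real.pi / 2)) := by
    refine (differentiableOn_cschSumReg hL).continuousOn.mono fun z hz => ?_
    have hz1 := (Complex.mem_reProdIm.1 hz).1
    change |z.re| < 3 * L / 4
    rw [abs_of_nonneg hz1.1]
    linarith [hz1.2]
  have huc := hK.uniformContinuousOn_of_continuous hKc
  rw [Metric.uniformContinuousOn_iff] at huc
  obtain ⟨η, hη, hηδ⟩ := huc δ hδ
  obtain ⟨ε, hε0, hεm⟩ := exists_between (lt_min hη hre0)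
  obtain ⟨hεη, hεw⟩ := lt_min_iff.1 hεm
  have hεL : ε < L / 2 := hεw.trans hre1
  have hleft : ∀ z : ℂ, z.re = ε → z.im ∈ Set.Icc 0 (Real.pi / 2) →
      -δ ≤ (cschSum L z).re := by
    intro z hzre hzim
    have h0 : (cschSumReg L (z.im * Complex.I)).re = 0 :=
      cschSumReg_re_of_re_eq_zero L (by simp)
    have hzK : z ∈ Set.Icc 0 (L / 2) ×ℂ Set.Icc 0 (Real.pi / 2) :=
      Complex.mem_reProdIm.2 ⟨by rw [hzre]; exact ⟨hε0.le, hεL.le⟩, hzim⟩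
    have hzK' : (z.im * Complex.I : ℂ) ∈ Set.Icc 0 (L / 2) ×ℂ Set.Icc 0 (Real.pi / 2) :=
      Complex.mem_reProdIm.2 ⟨by simpa using (half_pos hL).le, by simpa using hzim⟩
    have hdist : dist z (z.im * Complex.I) < η := by
      have : z - z.im * Complex.I = (ε : ℂ) := by
        apply Complex.ext <;> simp [hzre]
      rw [dist_eq_norm, this, Complex.norm_real, Real.norm_of_nonneg hε0.le]
      exact hεη
    have hd := hηδ z hzK _ hzK' hdist
    rw [dist_eq_norm] at hd
    have hd2 := (Complex.abs_re_le_norm _).trans_lt hd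
    rw [Complex.sub_re, h0, sub_zero, abs_lt] at hd2
    rw [cschSum_eq_add hL (by rw [hzre, abs_of_pos hε0]; linarith), Complex.add_re]
    have := inv_sinh_re_nonneg (w := z) (by rw [hzre]; exact hε0.le)
      (by rw [abs_of_nonneg hzim.1]; exact hzim.2)
    linarith [hd2.1]
  have hpi : (0 : ℝ) < Real.pi / 2 := by positivity
  set U : Set ℂ := Set.Ioo ε (L / 2) ×ℂ Set.Ioo 0 (Real.pi / 2) with hU
  have hcl : closure U = Set.Icc ε (L / 2) ×ℂ Set.Icc 0 (Real.pi / 2) := by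
    rw [hU, closure_Ioo_reProdIm_Ioo hεL hpi]
  have hdiff : DiffContOnCl ℂ (fun z => Complex.exp (-cschSum L z)) U :=
    diffContOnCl_exp_neg_cschSum hε0 hεL
  have hbd : Bornology.IsBounded U :=
    (Metric.isBounded_Ioo _ _).reProdIm (Metric.isBounded_Ioo _ _)
  have hfr : ∀ z ∈ frontier U, ‖Complex.exp (-cschSum L z)‖ ≤ Real.exp δ := by
    intro z hz
    rw [Complex.norm_exp, Real.exp_le_exp, Complex.neg_re, neg_le]
    rw [hU, Complex.frontier_reProdIm, closure_Ioo hεL.ne, closure_Ioo hpi.ne,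
      frontier_Ioo hεL, frontier_Ioo hpi] at hz
    rcases hz with ⟨hzre, him | him⟩ | ⟨rfl | hzre, hzim⟩
    · have him' : z.im = 0 := him
      have hzre' : z.re ∈ Set.Icc ε (L / 2) := hzre
      have hz' : z = (z.re : ℂ) := by apply Complex.ext <;> simp [him']
      rcases hzre'.2.lt_or_eq with hlt | heq
      · rw [hz']
        linarith [cschSum_ofReal_re_pos (hε0.trans_le hzre'.1) hlt]
      · rw [cschSum_re_of_two_mul_re (m := 1) (by rw [heq]; push_cast; ring)]
        linarith
    · have him' : z.im = Real.pi / 2 := him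
      rw [cschSum_re_of_im_eq_pi_div_two L him']
      linarith
    · exact hleft z rfl hzim
    · have hzre' : z.re = L / 2 := hzre
      rw [cschSum_re_of_two_mul_re (m := 1) (by rw [hzre']; push_cast; ring)]
      linarith
  have hw : w ∈ closure U := by
    rw [hcl]
    exact Complex.mem_reProdIm.2 ⟨⟨hεw.le, hre1.le⟩, him0, him1⟩
  have hmax := Complex.norm_le_of_forall_mem_frontier_norm_le hbd hdiff hfr hw
  rw [Complex.norm_exp, Real.exp_le_exp, Complex.neg_re] at hmax
  linarith

lemma cschSum_re_pos {L : ℝ} {w : ℂ} (hre0 : 0 < w.re) (hre1 : w.re < L / 2)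
    (him0 : 0 ≤ w.im) (him1 : w.im < Real.pi / 2) : 0 < (cschSum L w).re := by
  rcases him0.eq_or_lt with him | him
  · have hw : w = (w.re : ℂ) := by apply Complex.ext <;> simp [← him]
    rw [hw]
    exact cschSum_ofReal_re_pos hre0 hre1
  refine (cschSum_re_nonneg hre0 hre1 him0 him1.le).lt_of_ne' fun h0 => ?_
  obtain ⟨ε, hε0, hεw⟩ := exists_between hre0
  have hεL : ε < L / 2 := hεw.trans hre1
  have hpi : (0 : ℝ) < Real.pi / 2 := Real.pi_div_two_pos
  have hconn : IsPreconnected (Set.Ioo ε (L / 2) ×ℂ Set.Ioo 0 (Real.pi / 2)) :=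
    (((convex_Ioo ε (L / 2)).linear_preimage Complex.reLm).inter
      ((convex_Ioo 0 (Real.pi / 2)).linear_preimage Complex.imLm)).isPreconnected
  have hmax : IsMaxOn (norm ∘ fun z => Complex.exp (-cschSum L z))
      (Set.Ioo ε (L / 2) ×ℂ Set.Ioo 0 (Real.pi / 2)) w := by
    intro z hz
    obtain ⟨hzre, hzim⟩ := Complex.mem_reProdIm.1 hz
    have := cschSum_re_nonneg (hε0.trans hzre.1) hzre.2 hzim.1.le hzim.2.le
    simp only [Set.mem_ofPred_eq, Function.comp_apply, Complex.norm_exp, Real.exp_le_exp,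
      Complex.neg_re, h0]
    linarith
  have hconst := Complex.norm_eqOn_closure_of_isPreconnected_of_isMaxOn hconn
    (isOpen_Ioo.reProdIm isOpen_Ioo) (diffContOnCl_exp_neg_cschSum hε0 hεL)
    (Complex.mem_reProdIm.2 ⟨⟨hεw, hre1⟩, him, him1⟩) hmax
  have hmem : ((w.re : ℝ) : ℂ) ∈ closure (Set.Ioo ε (L / 2) ×ℂ Set.Ioo 0 (Real.pi / 2)) := by
    rw [closure_Ioo_reProdIm_Ioo hεL hpi]
    exact Complex.mem_reProdIm.2 ⟨⟨hεw.le, hre1.le⟩, by simpa using hpi.le⟩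
  have h1 := hconst hmem
  simp only [Function.comp_apply, Function.const_apply, Complex.norm_exp, Complex.neg_re, h0,
    Real.exp_eq_exp] at h1
  linarith [cschSum_ofReal_re_pos hre0 hre1]

lemma cschSum_re_eq_zero_iff {L : ℝ} (hL : 0 < L) {w : ℂ} (him0 : 0 ≤ w.im)
    (him1 : w.im < Real.pi / 2) :
    (cschSum L w).re = 0 ↔ ∃ m : ℤ, 2 * w.re = m * L := by
  refine ⟨fun h => ?_, fun ⟨m, hm⟩ => cschSum_re_of_two_mul_re hm⟩
  obtain ⟨m, hm⟩ : ∃ m : ℤ, |w.re + m * L| ≤ L / 2 := by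
    refine ⟨-round (w.re / L), ?_⟩
    have h1 := abs_sub_round (w.re / L)
    have h2 : w.re + ((-round (w.re / L) : ℤ) : ℝ) * L = (w.re / L - round (w.re / L)) * L := by
      push_cast
      field_simp
      ring
    rw [h2, abs_mul, abs_of_pos hL]
    nlinarith
  set v : ℂ := w + m * L with hv
  have hvre : v.re = w.re + m * L := by simp [hv]
  have hvim : v.im = w.im := by simp [hv]
  have hv0 : (cschSum L v).re = 0 := by rw [hv, cschSum_add_int_mul, h]
  rw [← hvre, abs_le] at hm
  suffices hcases : v.re = 0 ∨ v.re = L / 2 ∨ v.re = -(L / 2) by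
    rcases hcases with h1 | h1 | h1
    · exact ⟨-2 * m, by push_cast; linarith⟩
    · exact ⟨1 - 2 * m, by push_cast; linarith⟩
    · exact ⟨-1 - 2 * m, by push_cast; linarith⟩
  by_contra! hne
  obtain ⟨hne0, hne1, hne2⟩ := hne
  rcases hne0.lt_or_gt with hlt | hgt
  · have hpos := cschSum_re_pos (L := L) (w := -(starRingEnd ℂ) v) (by simpa using hlt)
      (by
        have := lt_of_le_of_ne hm.1 hne2.symm
        rw [Complex.neg_re, Complex.conj_re]
        linarith)
      (by simpa [hvim] using him0) (by simpa [hvim] using him1)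
    rw [cschSum_neg, cschSum_conj, Complex.neg_re, Complex.conj_re, hv0] at hpos
    linarith
  · have hpos := cschSum_re_pos hgt (lt_of_le_of_ne hm.2 hne1) (by rwa [hvim]) (by rwa [hvim])
    exact hpos.ne' hv0

lemma hqfun_exp (L : ℝ) (w : ℂ) : hqfun (Real.exp (-L)) (Complex.exp w) = cschSum L w := by
  rw [hqfun, cschSum]
  refine tsum_congr fun k => ?_
  have hp : ((Real.exp (-L) : ℝ) : ℂ) ^ k = Complex.exp (-(k * L)) := by
    rw [Complex.ofReal_exp, ← Complex.exp_int_mul]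
    congr 1
    push_cast
    ring
  have hz : Complex.exp w = Complex.exp (w + k * L) * Complex.exp (-(k * L)) := by
    rw [← Complex.exp_add]
    congr 1
    ring
  rw [mul_comm 2 k, zpow_mul, hp, hz, Complex.sinh, Complex.exp_neg (w + k * L)]
  have hy := Complex.exp_ne_zero (w + k * L)
  have hq := Complex.exp_ne_zero (-(k * L : ℂ))
  generalize Complex.exp (w + k * L) = y at *
  generalize Complex.exp (-(k * L : ℂ)) = p at *
  calc 2 * (y * p) * p / ((y * p) ^ 2 - p ^ (2 : ℤ))
      = 2 * y * p ^ 2 / ((y ^ 2 - 1) * p ^ 2) := by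
        congr 1
        · ring
        · rw [zpow_ofNat]
          ring
    _ = 2 * y / (y ^ 2 - 1) := mul_div_mul_right _ _ (pow_ne_zero 2 hq)
    _ = 2 * y / ((y - y⁻¹) * y) := by
        congr 1
        field_simp
    _ = ((y - y⁻¹) / 2)⁻¹ := by
        rw [mul_div_mul_right _ _ hy, inv_div]

theorem statement12 (q : ℝ) (hq0 : 0 < q) (hq1 : q < 1) :
    ∀ r : ℝ, 0 < r →
      ((hqfun q ((r : ℂ) * Complex.exp ((Real.pi / 4 : ℝ) * Complex.I))).re = 0 ↔
        ∃ k : ℤ, r = Real.sqrt q ^ k) := by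
  intro r hr
  have hL : 0 < -Real.log q := neg_pos.2 (Real.log_neg hq0 hq1)
  have hpi := Real.pi_pos
  set w : ℂ := (Real.log r : ℝ) + (Real.pi / 4 : ℝ) * Complex.I with hw
  have hwre : w.re = Real.log r := by simp [hw]
  have hwim : w.im = Real.pi / 4 := by
    rw [hw, Complex.add_im, Complex.ofReal_im, Complex.im_ofReal_mul, Complex.I_im]
    ring
  have hz : (r : ℂ) * Complex.exp ((Real.pi / 4 : ℝ) * Complex.I) = Complex.exp w := by
    rw [hw, Complex.exp_add, ← Complex.ofReal_exp, Real.exp_log hr]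
  have hq : q = Real.exp (-(-Real.log q)) := by rw [neg_neg, Real.exp_log hq0]
  have hh : hqfun q (Complex.exp w) = cschSum (-Real.log q) w := by
    rw [← hqfun_exp, ← hq]
  rw [hz, hh, cschSum_re_eq_zero_iff hL (by rw [hwim]; linarith) (by rw [hwim]; linarith), hwre]
  have hs : 0 < Real.sqrt q := Real.sqrt_pos.2 hq0
  have hiff : ∀ k : ℤ, r = Real.sqrt q ^ k ↔ 2 * Real.log r = k * Real.log q := by
    intro k
    rw [← Real.log_injOn_pos.eq_iff hr (zpow_pos hs k), Real.log_zpow, Real.log_sqrt hq0.le]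
    constructor <;> intro h <;> linarith
  simp only [hiff]
  constructor
  · rintro ⟨m, hm⟩
    exact ⟨-m, by push_cast; linarith⟩
  · rintro ⟨m, hm⟩
    exact ⟨-m, by push_cast; linarith⟩
end

section
/- For every real r > 0: Re h_q(r e^{iπ/4}) = Re h_q(r e^{−iπ/4}) = −Re h_q(r e^{3iπ/4}) = −Re h_q(r e^{−3iπ/4}), and Im h_q(r e^{iπ/4}) = Im h_q(r e^{3iπ/4}) = −Im h_q(r e^{−3iπ/4}) = −Im h_q(r e^{−iπ/4}) ≠ 0. -/
open Complex Topology

lemma hqfun_neg (q : ℝ) (z : ℂ) : hqfun q (-z) = -hqfun q z := by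
  unfold hqfun
  rw [← tsum_neg]
  congr 1
  ext k
  rw [neg_sq]
  ring

lemma hqfun_conj (q : ℝ) (z : ℂ) :
    hqfun q ((starRingEnd ℂ) z) = (starRingEnd ℂ) (hqfun q z) := by
  unfold hqfun
  rw [Complex.conj_tsum]
  congr 1
  ext k
  simp only [map_div₀, map_mul, map_sub, map_pow, map_zpow₀, Complex.conj_ofReal, map_ofNat]

/-- If `z ^ 2` is purely imaginary and nonzero, the bilateral series defining `h_q(z)` converges. -/
lemma summable_hqfun {q : ℝ} (hq0 : 0 < q) (hq1 : q < 1) {z : ℂ} (hre : (z ^ 2).re = 0)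
    (him : (z ^ 2).im ≠ 0) :
    Summable fun k : ℤ => 2 * z * (q : ℂ) ^ k / (z ^ 2 - (q : ℂ) ^ (2 * k)) := by
  have hcast (k : ℤ) : (q : ℂ) ^ (2 * k) = ((((q ^ k) ^ 2 : ℝ)) : ℂ) := by
    push_cast
    rw [mul_comm, zpow_mul]
    norm_cast
  have norm_term (k : ℤ) : ‖2 * z * (q : ℂ) ^ k / (z ^ 2 - (q : ℂ) ^ (2 * k))‖
      = 2 * ‖z‖ * q ^ k / ‖z ^ 2 - ((((q ^ k) ^ 2 : ℝ)) : ℂ)‖ := by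
    rw [hcast, norm_div, norm_mul, norm_mul, norm_zpow, Complex.norm_real,
      Real.norm_of_nonneg hq0.le, Complex.norm_ofNat]
  have hgeom := summable_geometric_of_lt_one hq0.le hq1
  refine Summable.of_nat_of_neg ?_ ?_
  · refine Summable.of_norm_bounded (hgeom.mul_left (2 * ‖z‖ / |(z ^ 2).im|)) fun n => ?_
    have hle : |(z ^ 2).im| ≤ ‖z ^ 2 - ((((q ^ (n : ℤ)) ^ 2 : ℝ)) : ℂ)‖ := by
      refine le_trans (le_of_eq ?_) (Complex.abs_im_le_norm _)
      rw [Complex.sub_im, Complex.ofReal_im, sub_zero]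
    rw [norm_term, div_mul_eq_mul_div, ← zpow_natCast q n]
    gcongr
  · refine Summable.of_norm_bounded (hgeom.mul_left (2 * ‖z‖)) fun n => ?_
    have hs : (0 : ℝ) < q ^ (-(n : ℤ)) := zpow_pos hq0 _
    have hle : (q ^ (-(n : ℤ))) ^ 2 ≤ ‖z ^ 2 - ((((q ^ (-(n : ℤ))) ^ 2 : ℝ)) : ℂ)‖ := by
      refine le_trans (le_of_eq ?_) (Complex.abs_re_le_norm _)
      rw [Complex.sub_re, Complex.ofReal_re, hre, zero_sub, abs_neg, abs_of_nonneg (by positivity)]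
    rw [norm_term]
    calc 2 * ‖z‖ * q ^ (-(n : ℤ)) / ‖z ^ 2 - ((((q ^ (-(n : ℤ))) ^ 2 : ℝ)) : ℂ)‖
        ≤ 2 * ‖z‖ * q ^ (-(n : ℤ)) / (q ^ (-(n : ℤ))) ^ 2 := by gcongr
      _ = 2 * ‖z‖ * (q ^ (-(n : ℤ)))⁻¹ := by field_simp
      _ = 2 * ‖z‖ * q ^ n := by rw [zpow_neg, inv_inv, zpow_natCast]

/-- On the diagonal `z = a (1 + i)` every term of the series has negative imaginary part. -/
lemma im_hqfun_term_neg {a s : ℝ} (ha : 0 < a) (hs : 0 < s) :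
    (2 * ((a : ℂ) * (1 + I)) * s / (((a : ℂ) * (1 + I)) ^ 2 - (s : ℂ) ^ 2)).im < 0 := by
  have hD : (0 : ℝ) < 4 * a ^ 4 + s ^ 4 := by positivity
  have hDC : (4 * (a : ℂ) ^ 4 + (s : ℂ) ^ 4) ≠ 0 := by exact_mod_cast hD.ne'
  have hfac : (((a : ℂ) * (1 + I)) ^ 2 - (s : ℂ) ^ 2) * (-(2 * a ^ 2 * I) - s ^ 2)
      = 4 * (a : ℂ) ^ 4 + (s : ℂ) ^ 4 := by
    linear_combination (-4 * (a : ℂ) ^ 4 - 2 * a ^ 4 * I - a ^ 2 * s ^ 2) * I_sq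
  have hterm : 2 * ((a : ℂ) * (1 + I)) * s / (((a : ℂ) * (1 + I)) ^ 2 - (s : ℂ) ^ 2)
      = ((2 * a * s * (2 * a ^ 2 - s ^ 2) / (4 * a ^ 4 + s ^ 4) : ℝ) : ℂ)
        + ((-(2 * a * s * (2 * a ^ 2 + s ^ 2) / (4 * a ^ 4 + s ^ 4)) : ℝ) : ℂ) * I := by
    have hne : ((a : ℂ) * (1 + I)) ^ 2 - (s : ℂ) ^ 2 ≠ 0 := left_ne_zero_of_mul (hfac ▸ hDC)
    push_cast
    rw [div_eq_iff hne]
    have hinv := mul_inv_cancel₀ hDC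
    linear_combination (-2 * a * s * (1 + I)) * hinv
      + 2 * a * s * (4 * (a : ℂ) ^ 4 + (s : ℂ) ^ 4)⁻¹ * (-(1 + I) * hfac
        - 2 * (a : ℂ) ^ 2 * (((a : ℂ) * (1 + I)) ^ 2 - (s : ℂ) ^ 2) * I_sq)
  rw [hterm, Complex.add_im, Complex.ofReal_im, Complex.im_ofReal_mul, Complex.I_im, zero_add,
    mul_one, neg_lt_zero]
  positivity

lemma im_hqfun_diagonal_neg {q : ℝ} (hq0 : 0 < q) (hq1 : q < 1) {a : ℝ} (ha : 0 < a) :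
    (hqfun q ((a : ℂ) * (1 + I))).im < 0 := by
  have hsq : ((a : ℂ) * (1 + I)) ^ 2 = ((2 * a ^ 2 : ℝ) : ℂ) * I := by
    push_cast
    linear_combination (a : ℂ) ^ 2 * I_sq
  have hsum := summable_hqfun hq0 hq1 (z := (a : ℂ) * (1 + I))
    (by rw [hsq, Complex.re_ofReal_mul, Complex.I_re, mul_zero])
    (by rw [hsq, Complex.im_ofReal_mul, Complex.I_im, mul_one]; positivity)
  have hneg (k : ℤ) : (2 * ((a : ℂ) * (1 + I)) * (q : ℂ) ^ k /
      (((a : ℂ) * (1 + I)) ^ 2 - (q : ℂ) ^ (2 * k))).im < 0 := by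
    have := im_hqfun_term_neg ha (zpow_pos hq0 k)
    rwa [Complex.ofReal_zpow, ← zpow_natCast ((q : ℂ) ^ k), ← zpow_mul, mul_comm k] at this
  have him := (Complex.hasSum_im hsum.hasSum).neg
  have hpos := him.summable.tsum_pos (fun k => (neg_pos.2 (hneg k)).le) 0 (neg_pos.2 (hneg 0))
  rw [him.tsum_eq] at hpos
  exact neg_pos.1 hpos

theorem statement13 (q : ℝ) (hq0 : 0 < q) (hq1 : q < 1) :
    ∀ r : ℝ, 0 < r →
      -- real-part symmetries
      ((hqfun q ((r : ℂ) * Complex.exp ((Real.pi / 4 : ℝ) * Complex.I))).re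
          = (hqfun q ((r : ℂ) * Complex.exp ((-(Real.pi / 4) : ℝ) * Complex.I))).re) ∧
      ((hqfun q ((r : ℂ) * Complex.exp ((Real.pi / 4 : ℝ) * Complex.I))).re
          = -(hqfun q ((r : ℂ) * Complex.exp ((3 * Real.pi / 4 : ℝ) * Complex.I))).re) ∧
      ((hqfun q ((r : ℂ) * Complex.exp ((Real.pi / 4 : ℝ) * Complex.I))).re
          = -(hqfun q ((r : ℂ) * Complex.exp ((-(3 * Real.pi / 4) : ℝ) * Complex.I))).re) ∧
      -- imaginary-part symmetries
      ((hqfun q ((r : ℂ) * Complex.exp ((Real.pi / 4 : ℝ) * Complex.I))).im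
          = (hqfun q ((r : ℂ) * Complex.exp ((3 * Real.pi / 4 : ℝ) * Complex.I))).im) ∧
      ((hqfun q ((r : ℂ) * Complex.exp ((Real.pi / 4 : ℝ) * Complex.I))).im
          = -(hqfun q ((r : ℂ) * Complex.exp ((-(3 * Real.pi / 4) : ℝ) * Complex.I))).im) ∧
      ((hqfun q ((r : ℂ) * Complex.exp ((Real.pi / 4 : ℝ) * Complex.I))).im
          = -(hqfun q ((r : ℂ) * Complex.exp ((-(Real.pi / 4) : ℝ) * Complex.I))).im) ∧
      (hqfun q ((r : ℂ) * Complex.exp ((Real.pi / 4 : ℝ) * Complex.I))).im ≠ 0 := by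
  intro r hr
  have hexp : Complex.exp ((Real.pi / 4 : ℝ) * I) = ((√2 / 2 : ℝ) : ℂ) * (1 + I) := by
    rw [Complex.exp_mul_I, ← Complex.ofReal_cos, ← Complex.ofReal_sin, Real.cos_pi_div_four,
      Real.sin_pi_div_four]
    ring
  set z : ℂ := (r : ℂ) * Complex.exp ((Real.pi / 4 : ℝ) * I) with hz
  have hconj : (r : ℂ) * Complex.exp ((-(Real.pi / 4) : ℝ) * I) = (starRingEnd ℂ) z := by
    rw [hz, map_mul, ← Complex.exp_conj, map_mul, Complex.conj_ofReal, Complex.conj_ofReal,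
      Complex.conj_I, Complex.ofReal_neg, neg_mul, mul_neg]
  have hneg : (r : ℂ) * Complex.exp ((-(3 * Real.pi / 4) : ℝ) * I) = -z := by
    have harg : ((-(3 * Real.pi / 4) : ℝ) : ℂ) * I = (Real.pi / 4 : ℝ) * I - Real.pi * I := by
      push_cast
      ring
    rw [harg, Complex.exp_sub_pi_mul_I, mul_neg]
  have hneg_conj : (r : ℂ) * Complex.exp ((3 * Real.pi / 4 : ℝ) * I) = -(starRingEnd ℂ) z := by
    have harg : ((3 * Real.pi / 4 : ℝ) : ℂ) * I = (-(Real.pi / 4) : ℝ) * I + Real.pi * I := by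
      push_cast
      ring
    rw [harg, Complex.exp_add_pi_mul_I, mul_neg, hconj]
  have him : (hqfun q z).im < 0 := by
    rw [hz, hexp, ← mul_assoc, ← Complex.ofReal_mul]
    exact im_hqfun_diagonal_neg hq0 hq1 (by positivity)
  rw [hconj, hneg, hneg_conj, hqfun_neg, hqfun_neg, hqfun_conj]
  simp [him.ne]
end

section
/- Let c ∈ (q, 1] and let {P_n^{(c)}}_{n≥0} be a family of monic orthogonal polynomials on the lattice ±c q^ℤ with weight w, with recurrence coefficients α_n^{(c)}, and set α_k^{(c)} = 0 for k ≤ 0. Then for every n ≥ 1: α_n^{(c)} ( α_{n+1}^{(c)} + q^{n−1} α_n^{(c)} + q^{−2} α_{n−1}^{(c)} − q^{2n−3} α_{n+1}^{(c)} α_n^{(c)} α_{n−1}^{(c)} ) = (q^{−n} − 1) q^{1−n}. -/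
open Polynomial Topology

/-- The weight `w(x) = ∏_{j=0}^∞ (1 + x⁴ q^{4j})⁻¹`. -/
noncomputable def qweight (q x : ℝ) : ℝ := ∏' j : ℕ, (1 + x ^ 4 * q ^ (4 * j))⁻¹

/-- A family of monic orthogonal polynomials on the lattice `±c qᶻ` with weight `qweight q`. -/
structure MonicOrthFamily (q c : ℝ) where
  P : ℕ → Polynomial ℝ
  γ : ℕ → ℝ
  monic : ∀ n, (P n).Monic
  deg : ∀ n, (P n).natDegree = n
  γ_pos : ∀ n, 0 < γ n
  abs_summable : ∀ n m : ℕ, Summable (fun k : ℤ =>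
    |((P n).eval (c * q ^ k) * (P m).eval (c * q ^ k) * qweight q (c * q ^ k)
      + (P n).eval (-(c * q ^ k)) * (P m).eval (-(c * q ^ k)) * qweight q (-(c * q ^ k)))
        * q ^ k|)
  orth : ∀ n m : ℕ,
    (∑' k : ℤ, ((P n).eval (c * q ^ k) * (P m).eval (c * q ^ k) * qweight q (c * q ^ k)
      + (P n).eval (-(c * q ^ k)) * (P m).eval (-(c * q ^ k)) * qweight q (-(c * q ^ k)))
        * q ^ k)
      = if n = m then γ n else 0

lemma qweight_neg (q x : ℝ) : qweight q (-x) = qweight q x := by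
  simp only [qweight, Even.neg_pow (by decide : Even 4)]

lemma qweight_q_mul {q : ℝ} (hq0 : 0 < q) (hq1 : q < 1) (x : ℝ) :
    qweight q (q * x) = (1 + x ^ 4) * qweight q x := by
  have hq4 : q ^ 4 < 1 := pow_lt_one₀ hq0.le hq1 (by norm_num)
  have hmul : Multipliable (fun j : ℕ => (1 + x ^ 4 * q ^ (4 * (j + 1)))⁻¹) := by
    have hs : Summable (fun j : ℕ =>
        ‖-(x ^ 4 * q ^ (4 * (j + 1))) / (1 + x ^ 4 * q ^ (4 * (j + 1)))‖) := by
      refine Summable.of_nonneg_of_le (fun _ => norm_nonneg _) (fun j => ?_)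
        ((summable_geometric_of_lt_one (by positivity) hq4).mul_left (x ^ 4 * q ^ 4))
      have h0 : 0 ≤ x ^ 4 * q ^ (4 * (j + 1)) := by positivity
      have h1 : x ^ 4 * q ^ 4 * (q ^ 4) ^ j = x ^ 4 * q ^ (4 * (j + 1)) := by
        rw [← pow_mul]; ring
      rw [h1, norm_div, norm_neg, Real.norm_of_nonneg h0, Real.norm_of_nonneg (by linarith)]
      exact div_le_self h0 (by linarith)
    refine (multipliable_one_add_of_summable hs).congr fun j => ?_
    have h0 : 0 ≤ x ^ 4 * q ^ (4 * (j + 1)) := by positivity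
    have h1 : 1 + x ^ 4 * q ^ (4 * (j + 1)) ≠ 0 := by linarith
    field_simp
    ring
  have h := tprod_eq_zero_mul' (f := fun j : ℕ => (1 + x ^ 4 * q ^ (4 * j))⁻¹) hmul
  have hx : 1 + x ^ 4 ≠ 0 := by positivity
  have hshift : qweight q (q * x) = ∏' j : ℕ, (1 + x ^ 4 * q ^ (4 * (j + 1)))⁻¹ := by
    unfold qweight
    congr 1
    ext j
    ring
  rw [hshift, show qweight q x = _ from h]
  simp [mul_inv_cancel_left₀ hx]

lemma degree_sub_C_coeff_mul_lt {p r : ℝ[X]} {m : ℕ} (hr : r.Monic) (hd : r.natDegree = m)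
    (hp : p.degree < (m + 1 : ℕ)) : (p - C (p.coeff m) * r).degree < m := by
  rw [degree_lt_iff_coeff_zero] at hp ⊢
  intro i hi
  rw [coeff_sub, coeff_C_mul]
  rcases hi.eq_or_lt with rfl | hi
  · have : r.coeff m = 1 := by rw [← hd]; exact hr
    simp [this]
  · rw [hp i hi, coeff_eq_zero_of_natDegree_lt (hd.trans_lt hi)]
    simp

namespace MonicOrthFamily

variable {q c : ℝ}

/-- The contribution of the two points `±c qᵏ` to the integral of a polynomial. -/
noncomputable def latticeTerm (q c : ℝ) (p : ℝ[X]) (k : ℤ) : ℝ :=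
  (p.eval (c * q ^ k) + p.eval (-(c * q ^ k))) * qweight q (c * q ^ k) * q ^ k

lemma latticeTerm_mul (p r : ℝ[X]) (k : ℤ) :
    (p.eval (c * q ^ k) * r.eval (c * q ^ k) * qweight q (c * q ^ k)
      + p.eval (-(c * q ^ k)) * r.eval (-(c * q ^ k)) * qweight q (-(c * q ^ k))) * q ^ k
      = latticeTerm q c (p * r) k := by
  simp only [latticeTerm, qweight_neg, eval_mul]
  ring

lemma P_zero (F : MonicOrthFamily q c) : F.P 0 = 1 :=
  (F.monic 0).natDegree_eq_zero.mp (F.deg 0)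

lemma coeff_self (F : MonicOrthFamily q c) (n : ℕ) : (F.P n).coeff n = 1 := by
  have h := F.monic n
  rwa [Monic, leadingCoeff, F.deg n] at h

lemma coeff_of_lt (F : MonicOrthFamily q c) {n i : ℕ} (h : n < i) : (F.P n).coeff i = 0 :=
  coeff_eq_zero_of_natDegree_lt (by rwa [F.deg n])

lemma summable_latticeTerm (F : MonicOrthFamily q c) (p : ℝ[X]) :
    Summable (latticeTerm q c p) := by
  suffices h : ∀ (m : ℕ) (p : ℝ[X]), p.degree < m → Summable (latticeTerm q c p) from
    h (p.natDegree + 1) p (degree_le_natDegree.trans_lt (by exact_mod_cast Nat.lt_succ_self _))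
  intro m
  induction m with
  | zero =>
    intro p hp
    have : p = 0 := by
      ext i
      exact (degree_lt_iff_coeff_zero p 0).mp hp i (Nat.zero_le i)
    subst this
    exact summable_zero.congr fun k => by simp [latticeTerm]
  | succ m ih =>
    intro p hp
    have h1 := ih _ (degree_sub_C_coeff_mul_lt (F.monic m) (F.deg m) hp)
    have h2 : Summable (latticeTerm q c (F.P m)) := by
      have h := (F.abs_summable m 0).of_abs
      simpa only [latticeTerm_mul, F.P_zero, mul_one] using h
    refine (h1.add (h2.mul_left (p.coeff m))).congr fun k => ?_
    simp only [latticeTerm, eval_sub, eval_mul, eval_C]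
    ring

/-- The linear functional on polynomials given by summation over the lattice. -/
noncomputable def functional (F : MonicOrthFamily q c) : ℝ[X] →ₗ[ℝ] ℝ where
  toFun p := ∑' k, latticeTerm q c p k
  map_add' p r := by
    rw [← (F.summable_latticeTerm p).tsum_add (F.summable_latticeTerm r)]
    congr 1
    ext k
    simp only [latticeTerm, eval_add]
    ring
  map_smul' t p := by
    rw [RingHom.id_apply, smul_eq_mul, ← tsum_mul_left]
    congr 1
    ext k
    simp only [latticeTerm, eval_smul, smul_eq_mul]
    ring

lemma functional_mul (F : MonicOrthFamily q c) (n m : ℕ) :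
    F.functional (F.P n * F.P m) = if n = m then F.γ n else 0 := by
  rw [← F.orth n m]
  simp only [latticeTerm_mul]
  rfl

lemma functional_comp (F : MonicOrthFamily q c) (hq0 : 0 < q) (hq1 : q < 1) (p : ℝ[X]) :
    F.functional p = q * F.functional ((1 + X ^ 4) * p.comp (C q * X)) := by
  change ∑' k, latticeTerm q c p k = q * ∑' k, latticeTerm q c _ k
  rw [← tsum_mul_left, ← (Equiv.addRight (1 : ℤ)).tsum_eq (latticeTerm q c p)]
  congr 1
  ext k
  have hx : c * q ^ (k + 1) = q * (c * q ^ k) := by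
    rw [zpow_add_one₀ hq0.ne']
    ring
  simp only [latticeTerm, Equiv.coe_addRight]
  rw [hx, qweight_q_mul hq0 hq1, zpow_add_one₀ hq0.ne']
  simp only [eval_mul, eval_add, eval_one, eval_pow, eval_X, eval_comp, eval_C]
  rw [Even.neg_pow (by decide : Even 4), mul_neg]
  ring

lemma functional_mul_eq_zero (F : MonicOrthFamily q c) (n : ℕ) {m : ℕ} (hm : m ≤ n) {p : ℝ[X]}
    (hp : p.degree < m) : F.functional (F.P n * p) = 0 := by
  induction m generalizing p with
  | zero =>
    have : p = 0 := by
      ext i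
      exact (degree_lt_iff_coeff_zero p 0).mp hp i (Nat.zero_le i)
    simp [this]
  | succ m ih =>
    have h := ih (by omega) (degree_sub_C_coeff_mul_lt (F.monic m) (F.deg m) hp)
    rw [mul_sub, mul_left_comm, ← smul_eq_C_mul, map_sub, map_smul, F.functional_mul,
      if_neg (by omega)] at h
    simpa using h

lemma functional_mul_of_degree_lt_succ (F : MonicOrthFamily q c) {n : ℕ} {p : ℝ[X]}
    (hp : p.degree < (n + 1 : ℕ)) : F.functional (F.P n * p) = p.coeff n * F.γ n := by
  have h := F.functional_mul_eq_zero n le_rfl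
    (degree_sub_C_coeff_mul_lt (F.monic n) (F.deg n) hp)
  rw [mul_sub, mul_left_comm, ← smul_eq_C_mul, map_sub, map_smul, F.functional_mul,
    if_pos rfl, smul_eq_mul] at h
  linarith

lemma functional_mul_of_degree_lt_add_three (F : MonicOrthFamily q c) {n : ℕ} {p : ℝ[X]}
    (hodd : (F.P (n + 1)).coeff n = 0) (hp : p.degree < (n + 3 : ℕ)) :
    F.functional (F.P n * p)
      = (p.coeff n - (F.P (n + 2)).coeff n * p.coeff (n + 2)) * F.γ n := by
  have h1 := degree_sub_C_coeff_mul_lt (F.monic (n + 2)) (F.deg (n + 2)) hp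
  have h2 := degree_sub_C_coeff_mul_lt (F.monic (n + 1)) (F.deg (n + 1)) h1
  have h := F.functional_mul_of_degree_lt_succ h2
  rw [mul_sub, mul_sub, mul_left_comm, mul_left_comm (F.P n), ← smul_eq_C_mul, ← smul_eq_C_mul,
    map_sub, map_sub, map_smul, map_smul, F.functional_mul, F.functional_mul,
    if_neg (by omega), if_neg (by omega)] at h
  simp only [smul_eq_mul, mul_zero, sub_zero, coeff_sub, coeff_C_mul, hodd] at h
  rw [h]
  ring

lemma P_one (F : MonicOrthFamily q c) : F.P 1 = X := by
  have h := F.functional_mul 1 0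
  have h0 := F.functional_mul 0 0
  have hX : F.functional X = 0 := by
    change ∑' k, latticeTerm q c X k = 0
    simp [latticeTerm]
  have h1 : F.P 1 = X + C ((F.P 1).coeff 0) := by
    have hd := eq_X_add_C_of_natDegree_le_one (F.deg 1).le
    rwa [F.coeff_self 1, C_1, one_mul] at hd
  rw [if_pos rfl, P_zero, mul_one] at h0
  rw [if_neg one_ne_zero, P_zero, mul_one, h1, map_add, hX, zero_add, ← mul_one (C _),
    ← smul_eq_C_mul, map_smul, h0, smul_eq_mul, mul_eq_zero] at h
  rw [h1, h.resolve_right (F.γ_pos 0).ne', C_0, add_zero]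

section Recurrence

variable (F : MonicOrthFamily q c) {a : ℕ → ℝ} (ha0 : a 0 = 0)
  (hrec : ∀ n : ℕ, X * F.P (n + 1) = F.P (n + 2) + C (a (n + 1)) * F.P n)

include hrec in
lemma coeff_succ_self (n : ℕ) : (F.P (n + 1)).coeff n = 0 := by
  induction n with
  | zero => simp [P_one]
  | succ n ih =>
    have h := congrArg (fun p => coeff p (n + 1)) (hrec n)
    simp only [coeff_X_mul, coeff_add, coeff_C_mul, ih, F.coeff_of_lt (Nat.lt_succ_self n)] at h
    simpa using h.symm

include ha0 hrec in
lemma coeff_add_two_self (n : ℕ) :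
    (F.P (n + 2)).coeff n = -∑ i ∈ Finset.range (n + 2), a i := by
  induction n with
  | zero =>
    have h := congrArg (fun p => coeff p 0) (hrec 0)
    simp [P_zero] at h
    simp [Finset.sum_range_succ, ha0]
    linarith
  | succ n ih =>
    have h := congrArg (fun p => coeff p (n + 1)) (hrec (n + 1))
    simp only [coeff_X_mul, coeff_add, coeff_C_mul, F.coeff_self, ih] at h
    rw [Finset.sum_range_succ]
    linarith

include ha0 hrec in
lemma mul_add_eq (hq0 : 0 < q) (hq1 : q < 1)
    (hγ : ∀ n : ℕ, F.γ (n + 1) = a (n + 1) * F.γ n) : q * (a 1 * (a 1 + a 2)) = 1 - q := by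
  have h := F.functional_comp hq0 hq1 1
  have h0 := F.functional_mul 0 0
  have h3 := F.functional_mul_of_degree_lt_add_three (n := 1) (p := X ^ 3)
    (F.coeff_succ_self hrec 1) (by rw [degree_X_pow]; norm_num)
  rw [P_zero, mul_one, if_pos rfl] at h0
  rw [P_one, ← pow_succ', F.coeff_add_two_self ha0 hrec, hγ 0] at h3
  simp [coeff_X_pow, Finset.sum_range_succ, ha0] at h3
  rw [one_comp, mul_one, map_add, h0, h3] at h
  refine mul_right_cancel₀ (F.γ_pos 0).ne' ?_
  linear_combination -h

include ha0 hrec in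
lemma sum_relation (hq0 : 0 < q) (hq1 : q < 1)
    (hγ : ∀ n : ℕ, F.γ (n + 1) = a (n + 1) * F.γ n) (m : ℕ) :
    (1 - q ^ 2) * ∑ i ∈ Finset.range (m + 2), a i
      = q * (q ^ m) ^ 2 * a (m + 1) * a (m + 2) *
        (q ^ 2 * ∑ i ∈ Finset.range (m + 4), a i - ∑ i ∈ Finset.range m, a i) := by
  have hq : q ≠ 0 := hq0.ne'
  set p := (F.P (m + 2)).comp (C q⁻¹ * X) with hp
  set r := (1 + X ^ 4) * (F.P m).comp (C q * X) with hr
  have hpc (i : ℕ) : p.coeff i = (F.P (m + 2)).coeff i * q⁻¹ ^ i := comp_C_mul_X_coeff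
  have hrc (i : ℕ) : r.coeff i = (F.P m).coeff i * q ^ i
      + if 4 ≤ i then (F.P m).coeff (i - 4) * q ^ (i - 4) else 0 := by
    rw [hr, add_mul, one_mul, coeff_add, coeff_X_pow_mul', comp_C_mul_X_coeff,
      comp_C_mul_X_coeff]
  have hpd : p.degree < (m + 3 : ℕ) := by
    rw [degree_lt_iff_coeff_zero]
    intro i hi
    rw [hpc, F.coeff_of_lt (by omega), zero_mul]
  have hrd : r.degree < (m + 2 + 3 : ℕ) := by
    rw [degree_lt_iff_coeff_zero]
    intro i hi
    rw [hrc, F.coeff_of_lt (by omega), if_pos (by omega), F.coeff_of_lt (by omega)]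
    simp
  have hpq : p.comp (C q * X) = F.P (m + 2) := by
    ext i
    rw [comp_C_mul_X_coeff, hpc, mul_assoc, ← mul_pow, inv_mul_cancel₀ hq, one_pow, mul_one]
  have hshift : F.functional (F.P m * p) = q * F.functional (F.P (m + 2) * r) := by
    rw [F.functional_comp hq0 hq1, mul_comp, hpq]
    congr 2
    rw [hr]
    ring
  have hr2 : q ^ 2 * r.coeff (m + 2) = -(∑ i ∈ Finset.range m, a i) * q ^ m := by
    rw [hrc, F.coeff_of_lt (by omega)]
    obtain _ | _ | k := m
    · simp
    · simp [ha0]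
    · rw [if_pos (by omega), show k + 1 + 1 + 2 - 4 = k by omega, F.coeff_add_two_self ha0 hrec]
      ring
  have hr4 : r.coeff (m + 4) = q ^ m := by
    rw [hrc, F.coeff_of_lt (by omega), if_pos (by omega), Nat.add_sub_cancel, F.coeff_self]
    ring
  rw [F.functional_mul_of_degree_lt_add_three (F.coeff_succ_self hrec m) hpd,
    F.functional_mul_of_degree_lt_add_three (F.coeff_succ_self hrec (m + 2)) hrd,
    hpc, hpc, F.coeff_self, F.coeff_add_two_self ha0 hrec m,
    F.coeff_add_two_self ha0 hrec (m + 2), show m + 2 + 2 = m + 4 from rfl, hr4, hγ (m + 1), hγ m,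
    inv_pow, inv_pow] at hshift
  refine mul_right_cancel₀ (F.γ_pos m).ne' ?_
  have hqm : q ^ m ≠ 0 := pow_ne_zero _ hq
  rw [pow_add q m 2] at hshift
  field_simp at hshift
  linear_combination hshift + q * q ^ m * a (m + 1) * a (m + 2) * F.γ m * hr2

end Recurrence

end MonicOrthFamily

/-- One step of the recursion, in terms of `U = qᵐ`. -/
lemma freud_step_sum {q U A B C S : ℝ} (hq0 : 0 < q) (hU : 0 < U) (hA : 0 ≤ A) (hB : 0 < B)
    (hJ : (1 - q ^ 2) * S * (q - U ^ 2 * A * B)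
      = (q - U ^ 2 * A * B) * (q ^ 2 * B + A) - q ^ 2 * U * (q * B + A))
    (hT : (q - U ^ 2 * A * B) * (1 - q * U ^ 2 * B * C) = q ^ 2 * U * (1 + U ^ 2 * B ^ 2)) :
    (1 - q ^ 2) * (S + B) * (1 - q * U ^ 2 * B * C)
      = (1 - q * U ^ 2 * B * C) * (q ^ 2 * C + B) - q ^ 2 * U * (q * C + B) := by
  have hZ : q - U ^ 2 * A * B ≠ 0 := by
    intro h
    rw [h] at hJ
    have : 0 < q ^ 2 * U * (q * B + A) := by positivity
    linarith
  refine mul_left_cancel₀ hZ ?_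
  linear_combination (1 - q * U ^ 2 * B * C) * hJ - (q ^ 2 * C - A) * hT

lemma freud_step {q U A B C D S : ℝ} (hq0 : 0 < q) (hB : 0 < B) (hC : 0 < C)
    (hT : (q - U ^ 2 * A * B) * (1 - q * U ^ 2 * B * C) = q ^ 2 * U * (1 + U ^ 2 * B ^ 2))
    (hJ : (1 - q ^ 2) * S * (1 - q * U ^ 2 * B * C)
      = (1 - q * U ^ 2 * B * C) * (q ^ 2 * C + B) - q ^ 2 * U * (q * C + B))
    (hI : (1 - q ^ 2) * S = q * U ^ 2 * B * C * (q ^ 2 * (S + C + D) - (S - B - A))) :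
    (1 - q * U ^ 2 * B * C) * (q - q ^ 4 * U ^ 2 * C * D)
      = q ^ 3 * U * (1 + q ^ 2 * U ^ 2 * C ^ 2) := by
  have hy : 0 < 1 + q * U ^ 2 * B * C := by positivity
  refine mul_left_cancel₀ hB.ne' ?_
  linear_combination q * (1 - q * U ^ 2 * B * C) * hI - q * (1 + q * U ^ 2 * B * C) * hJ - q ^ 2 * C * hT

/-- The recursion follows from positivity, its first instance, and the relation between
the partial sums. -/
lemma freud_recursion {q : ℝ} (hq0 : 0 < q) {a : ℕ → ℝ} (ha0 : a 0 = 0)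
    (ha : ∀ n, 0 < a (n + 1)) (h1 : q * (a 1 * (a 1 + a 2)) = 1 - q)
    (hI : ∀ m : ℕ, (1 - q ^ 2) * ∑ i ∈ Finset.range (m + 2), a i
      = q * (q ^ m) ^ 2 * a (m + 1) * a (m + 2) *
        (q ^ 2 * ∑ i ∈ Finset.range (m + 4), a i - ∑ i ∈ Finset.range m, a i)) (m : ℕ) :
    (q - (q ^ m) ^ 2 * a m * a (m + 1)) * (1 - q * (q ^ m) ^ 2 * a (m + 1) * a (m + 2))
      = q ^ 2 * q ^ m * (1 + (q ^ m) ^ 2 * a (m + 1) ^ 2) := by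
  suffices h : (1 - q ^ 2) * (∑ i ∈ Finset.range (m + 1), a i) * (q - (q ^ m) ^ 2 * a m * a (m + 1))
      = (q - (q ^ m) ^ 2 * a m * a (m + 1)) * (q ^ 2 * a (m + 1) + a m)
        - q ^ 2 * q ^ m * (q * a (m + 1) + a m) ∧
      (q - (q ^ m) ^ 2 * a m * a (m + 1)) * (1 - q * (q ^ m) ^ 2 * a (m + 1) * a (m + 2))
      = q ^ 2 * q ^ m * (1 + (q ^ m) ^ 2 * a (m + 1) ^ 2) from h.2
  induction m with
  | zero =>
    constructor
    · simp [ha0]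
      ring
    · simp only [ha0, pow_zero, zero_add]
      linear_combination -q * h1
  | succ m ih =>
    obtain ⟨hJ, hT⟩ := ih
    have ha_nonneg : 0 ≤ a m := by
      cases m with
      | zero => exact ha0.ge
      | succ k => exact (ha k).le
    have hJ' := freud_step_sum hq0 (pow_pos hq0 m) ha_nonneg (ha m) hJ hT
    have hI' := hI m
    rw [Finset.sum_range_succ _ (m + 3), Finset.sum_range_succ _ (m + 2),
      Finset.sum_range_succ _ (m + 1), Finset.sum_range_succ _ m] at hI'
    rw [Finset.sum_range_succ _ m] at hJ'
    have hT' := freud_step (D := a (m + 3)) hq0 (ha m) (ha (m + 1)) hT hJ'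
      (by linear_combination hI')
    rw [Finset.sum_range_succ _ (m + 1), Finset.sum_range_succ _ m, pow_succ]
    constructor
    · linear_combination q * hJ'
    · linear_combination hT'

theorem statement14 (q c : ℝ) (hq0 : 0 < q) (hq1 : q < 1) (hc1 : q < c) (hc2 : c ≤ 1)
    (F : MonicOrthFamily q c) (α : ℤ → ℝ)
    -- α_k = 0 for k ≤ 0
    (hα0 : ∀ k : ℤ, k ≤ 0 → α k = 0)
    -- recurrence coefficients α_n = γ_n / γ_{n-1} for n ≥ 1
    (hα : ∀ n : ℕ, 1 ≤ n → α (n : ℤ) = F.γ n / F.γ (n - 1))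
    -- three-term recurrence x P_n(x) = P_{n+1}(x) + α_n P_{n-1}(x)
    (hrec : ∀ n : ℕ, 1 ≤ n → ∀ x : ℝ,
      x * (F.P n).eval x = (F.P (n + 1)).eval x + α (n : ℤ) * (F.P (n - 1)).eval x) :
    ∀ n : ℤ, 1 ≤ n →
      α n * (α (n + 1) + q ^ (n - 1) * α n + q ^ (-2 : ℤ) * α (n - 1)
          - q ^ (2 * n - 3) * α (n + 1) * α n * α (n - 1))
        = (q ^ (-n) - 1) * q ^ (1 - n) := by
  intro n hn
  obtain ⟨m, rfl⟩ : ∃ m : ℕ, n = m + 1 := ⟨(n - 1).toNat, by omega⟩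
  have hγ (k : ℕ) : F.γ (k + 1) = α ((k + 1 : ℕ) : ℤ) * F.γ k := by
    rw [hα (k + 1) (by omega), Nat.add_sub_cancel, div_mul_cancel₀ _ (F.γ_pos k).ne']
  have ha (k : ℕ) : 0 < α ((k + 1 : ℕ) : ℤ) := by
    rw [hα (k + 1) (by omega)]
    exact div_pos (F.γ_pos _) (F.γ_pos _)
  have hP (k : ℕ) : X * F.P (k + 1) = F.P (k + 2) + C (α ((k + 1 : ℕ) : ℤ)) * F.P k := by
    refine Polynomial.funext fun x => ?_
    simpa using hrec (k + 1) (by omega) x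
  have ha0 : α ((0 : ℕ) : ℤ) = 0 := hα0 _ (by simp)
  have h := freud_recursion (a := fun k : ℕ => α k) hq0 ha0 ha
    (F.mul_add_eq (a := fun k : ℕ => α k) ha0 hP hq0 hq1 hγ)
    (F.sum_relation (a := fun k : ℕ => α k) ha0 hP hq0 hq1 hγ) m
  have hq : q ≠ 0 := hq0.ne'
  have hqm : q ^ m ≠ 0 := pow_ne_zero _ hq
  have e1 : q ^ ((m : ℤ) + 1 - 1) = q ^ m := by simp
  have e2 : q ^ (2 * ((m : ℤ) + 1) - 3) = (q ^ m) ^ 2 / q := by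
    rw [show 2 * ((m : ℤ) + 1) - 3 = (m : ℤ) * 2 - 1 by ring, zpow_sub_one₀ hq, zpow_mul,
      zpow_natCast, div_eq_mul_inv]
    norm_cast
  have e3 : q ^ (-((m : ℤ) + 1)) = (q ^ m * q)⁻¹ := by
    rw [zpow_neg, zpow_add_one₀ hq, zpow_natCast]
  have e4 : q ^ (1 - ((m : ℤ) + 1)) = (q ^ m)⁻¹ := by
    rw [show 1 - ((m : ℤ) + 1) = -(m : ℤ) by ring, zpow_neg, zpow_natCast]
  have e5 : q ^ (-2 : ℤ) = (q ^ 2)⁻¹ := by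
    rw [zpow_neg]
    norm_cast
  rw [e1, e2, e3, e4, e5, add_sub_cancel_right, show (m : ℤ) + 1 + 1 = (m : ℤ) + 2 by ring]
  push_cast at h
  field_simp
  linear_combination -h
end
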